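/- Under the standing assumptions, (h^𝔹, f)_{f ∈ C_c^∞(ℝ^d)} is a Gaussian process: for every finite collection f₁, …, f_k ∈ C_c^∞(ℝ^d) and reals λ₁, …, λ_k, the random variable Σᵢ λᵢ (h^𝔹, fᵢ) is a (possibly degenerate) centered Gaussian random variable. -/

import Mathlib

open MeasureTheory ProbabilityTheory Metric Filter Topology Set

noncomputable section

abbrev Euc (d : ℕ) : Type := EuclideanSpace ℝ (Fin d)

/-- The scaling function `s`: `s(r) = -log r` if `d = 2`, and `s(r) = r^(2-d)` if `d ≥ 3`. -/
noncomputable def sFun (d : ℕ) (r : ℝ) : ℝ :=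
  if d = 2 then -Real.log r else r ^ ((2 : ℝ) - (d : ℝ))

open Classical in
/-- The zero boundary Green's function of the open unit ball in `ℝ^d`:
`G(x,y) = s(|x-y|) - s(|x|·|y - x/|x|²|)`, interpreted by continuity at `x = 0`. -/
noncomputable def greenBall (d : ℕ) (x y : Euc d) : ℝ :=
  if x = 0 then sFun d ‖y‖ - sFun d 1
  else sFun d ‖x - y‖ - sFun d (‖x‖ * ‖y - (‖x‖ ^ 2)⁻¹ • x‖)

/-- Smooth compactly supported test functions. -/
def IsTestFun {d : ℕ} (f : Euc d → ℝ) : Prop :=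
  ContDiff ℝ (⊤ : ℕ∞) f ∧ HasCompactSupport f

/-- The Laplacian of `u : ℝ^d → ℝ` at `x`, as the sum of pure second derivatives in the
coordinate directions. -/
noncomputable def lap {d : ℕ} (u : Euc d → ℝ) (x : Euc d) : ℝ :=
  ∑ i : Fin d, iteratedFDeriv ℝ 2 u x ![EuclideanSpace.single i 1, EuclideanSpace.single i 1]

/-- A function is harmonic on a set if it is twice continuously differentiable there with
vanishing Laplacian. -/
def IsHarmonicOn {d : ℕ} (u : Euc d → ℝ) (s : Set (Euc d)) : Prop :=
  ContDiffOn ℝ 2 u s ∧ ∀ x ∈ s, lap u x = 0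

/-- A real random variable is a (possibly degenerate) centered Gaussian. -/
def IsCenteredGaussianRV {Ω : Type} [MeasurableSpace Ω] (P : Measure Ω) (Y : Ω → ℝ) : Prop :=
  ∃ v : NNReal, Measure.map Y P = ProbabilityTheory.gaussianReal 0 v

/-- The standing assumptions: a collection of stochastic processes `h a r` (thought of as
`h^{a + r𝔹}`) indexed by test functions, which is centered, a.s. linear, zero outside the ball,
translation/scaling covariant, satisfies the domain Markov property (with the decomposition
recorded as data `H`, `Φ`, `φharm`), has fourth moments, a (sequentially) continuous covariance
bilinear form on `C_c^∞(𝔹)`, and zero boundary conditions. -/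
structure GFF (d : ℕ) (Ω : Type) [MeasurableSpace Ω] where
  P : Measure Ω
  prob : IsProbabilityMeasure P
  /-- the field `h^{a+r𝔹}` tested against `f` -/
  h : Euc d → ℝ → (Euc d → ℝ) → Ω → ℝ
  meas_h : ∀ a r f, Measurable (h a r f)
  integrable_h : ∀ a r f, IsTestFun f → Integrable (h a r f) P
  /-- centered -/
  centered : ∀ a r f, IsTestFun f → ∫ ω, h a r f ω ∂P = 0
  /-- (1) a.s. linearity in the test function -/
  lin_add : ∀ f g : Euc d → ℝ, IsTestFun f → IsTestFun g →
    ∀ᵐ ω ∂P, h 0 1 (f + g) ω = h 0 1 f ω + h 0 1 g ω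
  lin_smul : ∀ (c : ℝ) (f : Euc d → ℝ), IsTestFun f →
    ∀ᵐ ω ∂P, h 0 1 (c • f) ω = c * h 0 1 f ω
  /-- (2) the field vanishes on test functions supported outside the ball -/
  zero_outside : ∀ f : Euc d → ℝ, IsTestFun f → tsupport f ⊆ (ball (0 : Euc d) 1)ᶜ →
    ∀ᵐ ω ∂P, h 0 1 f ω = 0
  /-- (3) translation and scaling: `(h^{a+r𝔹}, f((·-a)/r)) = r^{1+d/2} (h^𝔹, f)` in law,
  as processes (equality of finite dimensional distributions) -/
  scaling : ∀ (a : Euc d) (r : ℝ), 0 < r → ∀ (k : ℕ) (f : Fin k → Euc d → ℝ),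
    (∀ i, IsTestFun (f i)) →
    Measure.map (fun ω (i : Fin k) => h a r (fun x => f i (r⁻¹ • (x - a))) ω) P
      = Measure.map (fun ω (i : Fin k) => r ^ (1 + (d : ℝ) / 2) * h 0 1 (f i) ω) P
  /-- (4) domain Markov property: the decomposition data. `H a r` is the independent copy of
  `h^{a+r𝔹}`, `Φ a r` is the harmonic part as a process, `φharm a r ω` is the harmonic function. -/
  H : Euc d → ℝ → (Euc d → ℝ) → Ω → ℝ
  Φ : Euc d → ℝ → (Euc d → ℝ) → Ω → ℝ
  φharm : Euc d → ℝ → Ω → Euc d → ℝ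
  meas_H : ∀ a r f, Measurable (H a r f)
  meas_Φ : ∀ a r f, Measurable (Φ a r f)
  meas_φharm : ∀ a r z, Measurable fun ω => φharm a r ω z
  dmp_decomp : ∀ (a : Euc d) (r : ℝ), 0 < r → ball a r ⊆ ball (0 : Euc d) 1 →
    ∀ f : Euc d → ℝ, IsTestFun f → ∀ᵐ ω ∂P, h 0 1 f ω = H a r f ω + Φ a r f ω
  dmp_indep : ∀ (a : Euc d) (r : ℝ), 0 < r → ball a r ⊆ ball (0 : Euc d) 1 →
    ProbabilityTheory.Indep
      (⨆ f : {f : Euc d → ℝ // IsTestFun f}, MeasurableSpace.comap (H a r f.1) inferInstance)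
      ((⨆ f : {f : Euc d → ℝ // IsTestFun f}, MeasurableSpace.comap (Φ a r f.1) inferInstance) ⊔
        (⨆ z : Euc d, MeasurableSpace.comap (fun ω => φharm a r ω z) inferInstance)) P
  dmp_law : ∀ (a : Euc d) (r : ℝ), 0 < r → ball a r ⊆ ball (0 : Euc d) 1 →
    ∀ (k : ℕ) (f : Fin k → Euc d → ℝ), (∀ i, IsTestFun (f i)) →
    Measure.map (fun ω (i : Fin k) => H a r (f i) ω) P
      = Measure.map (fun ω (i : Fin k) => h a r (f i) ω) P
  dmp_harm : ∀ (a : Euc d) (r : ℝ), 0 < r → ball a r ⊆ ball (0 : Euc d) 1 →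
    ∀ᵐ ω ∂P, IsHarmonicOn (φharm a r ω) (ball a r) ∧
      ∀ f : Euc d → ℝ, IsTestFun f → tsupport f ⊆ ball a r →
        Φ a r f ω = ∫ x in ball a r, φharm a r ω x * f x
  /-- (5) fourth moments -/
  mom4 : ∀ f : Euc d → ℝ, IsTestFun f → Integrable (fun ω => (h 0 1 f ω) ^ 4) P
  /-- (6) sequential continuity of the covariance bilinear form on `C_c^∞(𝔹)` -/
  K2_cont : ∀ (f : ℕ → Euc d → ℝ) (f₀ g : Euc d → ℝ) (K : Set (Euc d)),
    IsCompact K → K ⊆ ball (0 : Euc d) 1 →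
    (∀ n, IsTestFun (f n)) → IsTestFun f₀ → IsTestFun g → tsupport g ⊆ ball (0 : Euc d) 1 →
    (∀ n, tsupport (f n) ⊆ K) → tsupport f₀ ⊆ K →
    (∀ m : ℕ, TendstoUniformly (fun n => iteratedFDeriv ℝ m (f n)) (iteratedFDeriv ℝ m f₀) atTop) →
    Tendsto (fun n => ∫ ω, h 0 1 (f n) ω * h 0 1 g ω ∂P) atTop
      (𝓝 (∫ ω, h 0 1 f₀ ω * h 0 1 g ω ∂P))
  /-- (7) zero boundary conditions -/
  zero_bdry : ∀ f : ℕ → Euc d → ℝ,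
    (∀ n, IsTestFun (f n)) → (∀ n x, 0 ≤ f n x) →
    (∃ C : ℝ, ∀ n, ∫ x, f n x ≤ C) →
    Tendsto (fun n => Metric.infDist (0 : Euc d) (tsupport (f n))) atTop (𝓝 1) →
    (∃ C : ℝ, ∀ (n : ℕ) (x y : Euc d), ‖x‖ = ‖y‖ → ‖x‖ < 1 → f n x ≤ C * f n y) →
    Tendsto (fun n => ∫ ω, (h 0 1 (f n) ω) ^ 2 ∂P) atTop (𝓝 0)

instance {d : ℕ} {Ω : Type} [MeasurableSpace Ω] (X : GFF d Ω) : IsProbabilityMeasure X.P :=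
  X.prob

/-! ### Test functions and the Laplacian -/

theorem IsTestFun.add {d : ℕ} {f g : Euc d → ℝ} (hf : IsTestFun f) (hg : IsTestFun g) :
    IsTestFun (f + g) := ⟨hf.1.add hg.1, hf.2.add hg.2⟩

theorem IsTestFun.smul {d : ℕ} {f : Euc d → ℝ} (c : ℝ) (hf : IsTestFun f) :
    IsTestFun (c • f) := ⟨hf.1.const_smul c, hf.2.smul_left (f := fun _ => c)⟩

theorem IsTestFun.neg {d : ℕ} {f : Euc d → ℝ} (hf : IsTestFun f) : IsTestFun (-f) := by
  simpa using hf.smul (-1)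

theorem IsTestFun.sub {d : ℕ} {f g : Euc d → ℝ} (hf : IsTestFun f) (hg : IsTestFun g) :
    IsTestFun (f - g) := by
  simpa [sub_eq_add_neg] using hf.add hg.neg

theorem isTestFun_zero {d : ℕ} : IsTestFun (0 : Euc d → ℝ) :=
  ⟨contDiff_const, HasCompactSupport.zero⟩

theorem IsTestFun.sum {d : ℕ} {ι : Type*} (s : Finset ι) {f : ι → Euc d → ℝ}
    (hf : ∀ i ∈ s, IsTestFun (f i)) : IsTestFun (∑ i ∈ s, f i) := by
  classical
  induction s using Finset.induction_on with
  | empty => simpa using isTestFun_zero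
  | insert a s ha ih =>
    rw [Finset.sum_insert ha]
    exact (hf a (by simp)).add (ih fun i hi => hf i (by simp [hi]))

theorem IsTestFun.mul_left {d : ℕ} {f g : Euc d → ℝ} (hf : ContDiff ℝ (⊤ : ℕ∞) f)
    (hg : IsTestFun g) : IsTestFun (f * g) := ⟨hf.mul hg.1, hg.2.mul_left⟩

theorem IsTestFun.mul_right {d : ℕ} {f g : Euc d → ℝ} (hf : IsTestFun f)
    (hg : ContDiff ℝ (⊤ : ℕ∞) g) : IsTestFun (f * g) := ⟨hf.1.mul hg, hf.2.mul_right⟩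

theorem IsTestFun.fderiv_apply {d : ℕ} {f : Euc d → ℝ} (hf : IsTestFun f) (v : Euc d) :
    IsTestFun (fun x => fderiv ℝ f x v) := by
  refine ⟨?_, hf.2.fderiv_apply ℝ v⟩
  exact (hf.1.fderiv_right (m := (⊤ : ℕ∞)) (by simp)).clm_apply contDiff_const

theorem IsTestFun.comp_affine {d : ℕ} {f : Euc d → ℝ} (hf : IsTestFun f) (a : Euc d) {r : ℝ}
    (hr : 0 < r) : IsTestFun (fun x => f (a + r • x)) := by
  refine ⟨hf.1.comp (by fun_prop), ?_⟩
  have e : (fun x => f (a + r • x)) =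
      f ∘ ((Homeomorph.smulOfNeZero r hr.ne').trans (Homeomorph.addLeft a)) := rfl
  rw [e]
  exact hf.2.comp_homeomorph _

/-- The `i`-th partial derivative. -/
def pd {d : ℕ} (i : Fin d) (u : Euc d → ℝ) (x : Euc d) : ℝ :=
  fderiv ℝ u x (EuclideanSpace.single i 1)

theorem lap_eq_sum_pd {d : ℕ} {u : Euc d → ℝ} {x : Euc d} (hu : ContDiffAt ℝ 2 u x) :
    lap u x = ∑ i, pd i (pd i u) x := by
  have h : DifferentiableAt ℝ (fderiv ℝ u) x :=
    (hu.fderiv_right (m := 1) (by norm_num)).differentiableAt (by norm_num)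
  refine Finset.sum_congr rfl fun i _ => ?_
  rw [iteratedFDeriv_two_apply]
  change _ = fderiv ℝ (fun y => fderiv ℝ u y (EuclideanSpace.single i 1)) x _
  rw [fderiv_clm_apply h (by fun_prop)]
  simp

theorem lap_congr {d : ℕ} {u v : Euc d → ℝ} {x : Euc d} (h : u =ᶠ[𝓝 x] v) :
    lap u x = lap v x := by
  simp only [lap, (h.iteratedFDeriv ℝ 2).eq_of_nhds]

theorem lap_zero {d : ℕ} (x : Euc d) : lap (0 : Euc d → ℝ) x = 0 := by
  simp [lap]

theorem lap_eq_zero_of_notMem_tsupport {d : ℕ} {u : Euc d → ℝ} {x : Euc d}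
    (h : x ∉ tsupport u) : lap u x = 0 := by
  rw [lap_congr (notMem_tsupport_iff_eventuallyEq.1 h), lap_zero]

theorem lap_add {d : ℕ} {u v : Euc d → ℝ} (hu : ContDiff ℝ 2 u) (hv : ContDiff ℝ 2 v) :
    lap (u + v) = lap u + lap v := by
  ext x
  simp only [lap, Pi.add_apply, iteratedFDeriv_add_apply hu.contDiffAt hv.contDiffAt,
    add_apply, Finset.sum_add_distrib]

theorem lap_smul {d : ℕ} {u : Euc d → ℝ} (c : ℝ) (hu : ContDiff ℝ 2 u) :
    lap (c • u) = c • lap u := by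
  ext x
  simp only [lap, Pi.smul_apply, iteratedFDeriv_const_smul_apply hu.contDiffAt,
    smul_apply, Finset.smul_sum]

theorem IsTestFun.contDiff_two {d : ℕ} {f : Euc d → ℝ} (hf : IsTestFun f) : ContDiff ℝ 2 f :=
  hf.1.of_le (WithTop.coe_le_coe.2 le_top)

theorem IsTestFun.lap_eq {d : ℕ} {f : Euc d → ℝ} (hf : IsTestFun f) :
    lap f = ∑ i, pd i (pd i f) := by
  ext x
  rw [lap_eq_sum_pd hf.contDiff_two.contDiffAt, Finset.sum_apply]

theorem IsTestFun.lap {d : ℕ} {f : Euc d → ℝ} (hf : IsTestFun f) : IsTestFun (lap f) := by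
  rw [hf.lap_eq]
  exact IsTestFun.sum _ fun i _ => (hf.fderiv_apply _).fderiv_apply _

theorem lap_sum {d : ℕ} {ι : Type*} (s : Finset ι) {f : ι → Euc d → ℝ}
    (hf : ∀ i ∈ s, IsTestFun (f i)) : lap (∑ i ∈ s, f i) = ∑ i ∈ s, lap (f i) := by
  classical
  induction s using Finset.induction_on with
  | empty => ext x; simp [lap_zero]
  | insert a s ha ih =>
    have h2 : ∀ i ∈ s, IsTestFun (f i) := fun i hi => hf i (by simp [hi])
    rw [Finset.sum_insert ha, Finset.sum_insert ha, lap_add (hf a (by simp)).contDiff_two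
      (IsTestFun.sum _ h2).contDiff_two, ih h2]

/-- Integrating a function harmonic in a ball against the Laplacian of a test function compactly
supported in the ball gives zero. -/
theorem integral_harmonic_mul_lap {d : ℕ} {φ g : Euc d → ℝ} {a : Euc d} {r : ℝ}
    (hφ : IsHarmonicOn φ (ball a r)) (hg : IsTestFun g) (hgs : tsupport g ⊆ ball a r) :
    ∫ x in ball a r, φ x * lap g x = 0 := by
  rcases le_or_gt r 0 with hr | hr
  · simp [ball_eq_empty.2 hr]
  obtain ⟨r1, ⟨hr1, hr1'⟩, hs⟩ := exists_pos_lt_subset_ball hr (isClosed_tsupport g) hgs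
  let ψ : ContDiffBump a := ⟨r1, (r1 + r) / 2, hr1, by linarith⟩
  have hψ1 : ∀ x ∈ ball a r1, ψ =ᶠ[𝓝 x] 1 := fun x hx =>
    ψ.eventuallyEq_one_of_mem_ball hx
  have hψs : tsupport ψ ⊆ ball a r := by
    rw [ψ.tsupport_eq]
    exact closedBall_subset_ball (by simp only [ψ]; linarith)
  set u : Euc d → ℝ := fun x => ψ x * φ x with hu
  have huC : ContDiff ℝ 2 u := by
    rw [contDiff_iff_contDiffAt]
    intro x
    by_cases hx : x ∈ ball a r
    · exact (ψ.contDiff (n := 2)).contDiffAt.mul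
        ((hφ.1 x hx).contDiffAt (isOpen_ball.mem_nhds hx))
    · have : u =ᶠ[𝓝 x] 0 := by
        filter_upwards [notMem_tsupport_iff_eventuallyEq.1 fun h => hx (hψs h)] with y hy
        simp [hu, hy]
      exact contDiffAt_const.congr_of_eventuallyEq this
  have huc : HasCompactSupport u := ψ.hasCompactSupport.mul_right
  have hpd1 : ∀ i, ContDiff ℝ 1 (pd i u) := fun i =>
    (huC.fderiv_right (m := 1) (by norm_num)).clm_apply contDiff_const
  have hgc := hg.contDiff_two
  have hpg1 : ∀ i, ContDiff ℝ 1 (pd i g) := fun i =>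
    (hgc.fderiv_right (m := 1) (by norm_num)).clm_apply contDiff_const
  have hcs : ∀ i, HasCompactSupport (pd i g) := fun i => hg.2.fderiv_apply ℝ _
  have hcs2 : ∀ i, HasCompactSupport (pd i (pd i g)) := fun i => (hcs i).fderiv_apply ℝ _
  have hpdc : ∀ {w : Euc d → ℝ} (i : Fin d), ContDiff ℝ 1 w → Continuous (pd i w) := fun i hw =>
    (hw.continuous_fderiv (by norm_num)).clm_apply continuous_const
  have key : ∀ i, ∫ x, u x * pd i (pd i g) x = ∫ x, pd i (pd i u) x * g x := by
    intro i
    have h1 := integral_mul_fderiv_eq_neg_fderiv_mul_of_integrable (μ := volume) (f := u)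
      (g := pd i g) (v := EuclideanSpace.single i 1)
      (((hpdc i (huC.of_le (by norm_num))).mul (hpg1 i).continuous).integrable_of_hasCompactSupport
        ((hcs i).mul_left))
      ((huC.continuous.mul (hpdc i (hpg1 i))).integrable_of_hasCompactSupport
        ((hcs2 i).mul_left))
      ((huC.continuous.mul (hpg1 i).continuous).integrable_of_hasCompactSupport
        ((hcs i).mul_left))
      (fun x _ => huC.differentiable (by norm_num) x)
      (fun x _ => (hpg1 i).differentiable (by norm_num) x)
    have h2 := integral_mul_fderiv_eq_neg_fderiv_mul_of_integrable (μ := volume) (f := pd i u)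
      (g := g) (v := EuclideanSpace.single i 1)
      (((hpdc i (hpd1 i)).mul hgc.continuous).integrable_of_hasCompactSupport (hg.2.mul_left))
      (((hpd1 i).continuous.mul (hpg1 i).continuous).integrable_of_hasCompactSupport
        ((hcs i).mul_left))
      (((hpd1 i).continuous.mul hgc.continuous).integrable_of_hasCompactSupport (hg.2.mul_left))
      (fun x _ => (hpd1 i).differentiable (by norm_num) x)
      (fun x _ => hgc.differentiable (by norm_num) x)
    calc ∫ x, u x * pd i (pd i g) x = -∫ x, pd i u x * pd i g x := h1
      _ = ∫ x, pd i (pd i u) x * g x := by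
        rw [show ∫ x, pd i u x * pd i g x = - ∫ x, pd i (pd i u) x * g x from h2, neg_neg]
  have e1 : ∀ x, x ∈ ball a r → φ x * lap g x = u x * lap g x := by
    intro x _
    by_cases hxg : x ∈ tsupport g
    · have : ψ x = 1 := (hψ1 x (hs hxg)).eq_of_nhds
      simp [hu, this]
    · simp [lap_eq_zero_of_notMem_tsupport hxg]
  have e2 : ∀ x, lap u x * g x = 0 := by
    intro x
    by_cases hxg : x ∈ tsupport g
    · have : u =ᶠ[𝓝 x] φ := by
        filter_upwards [hψ1 x (hs hxg)] with y hy
        simp [hu, hy]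
      rw [lap_congr this, hφ.2 x (hgs hxg), zero_mul]
    · rw [image_eq_zero_of_notMem_tsupport hxg, mul_zero]
  rw [setIntegral_congr_fun measurableSet_ball e1,
    setIntegral_eq_integral_of_forall_compl_eq_zero]
  · calc ∫ x, u x * lap g x = ∫ x, ∑ i, u x * pd i (pd i g) x := by
          simp [hg.lap_eq, Finset.mul_sum]
      _ = ∑ i, ∫ x, u x * pd i (pd i g) x := integral_finsetSum _ fun i _ =>
          (huC.continuous.mul (hpdc i (hpg1 i))).integrable_of_hasCompactSupport
            ((hcs2 i).mul_left)
      _ = ∑ i, ∫ x, pd i (pd i u) x * g x := Finset.sum_congr rfl fun i _ => key i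
      _ = ∫ x, ∑ i, pd i (pd i u) x * g x := (integral_finsetSum _ fun i _ =>
          ((hpdc i (hpd1 i)).mul hgc.continuous).integrable_of_hasCompactSupport
            (hg.2.mul_left)).symm
      _ = ∫ x, lap u x * g x := by
          congr 1; ext x; rw [lap_eq_sum_pd huC.contDiffAt, Finset.sum_mul]
      _ = 0 := by simp [e2]
  · intro x hx
    rw [lap_eq_zero_of_notMem_tsupport fun h => hx (hgs h), mul_zero]

/-! ### Characteristic functions of real random variables -/

section Expectation

variable {Ω : Type} [MeasurableSpace Ω] {P : Measure Ω} [IsProbabilityMeasure P]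

theorem integrable_cexp {Y : Ω → ℝ} (hY : AEStronglyMeasurable Y P) :
    Integrable (fun ω => Complex.exp (Complex.I * Y ω)) P := by
  refine Integrable.of_bound (C := 1) ?_ ?_
  · exact (by fun_prop : Continuous fun t : ℝ =>
      Complex.exp (Complex.I * t)).comp_aestronglyMeasurable hY
  · exact ae_of_all _ fun ω => by rw [mul_comm, Complex.norm_exp_ofReal_mul_I]

theorem norm_integral_cexp_le_one (Y : Ω → ℝ) :
    ‖∫ ω, Complex.exp (Complex.I * Y ω) ∂P‖ ≤ 1 := by
  have := norm_integral_le_of_norm_le_const (μ := P) (C := 1)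
    (f := fun ω => Complex.exp (Complex.I * Y ω))
    (ae_of_all _ fun ω => by rw [mul_comm, Complex.norm_exp_ofReal_mul_I])
  simpa using this

theorem integral_abs_le_eLpNorm_two {Y : Ω → ℝ} (hY : MemLp Y 2 P) :
    ∫ ω, |Y ω| ∂P ≤ (eLpNorm Y 2 P).toReal := by
  have h1 : eLpNorm Y 1 P ≤ eLpNorm Y 2 P :=
    eLpNorm_le_eLpNorm_of_exponent_le (by norm_num) hY.1
  have h2 := ENNReal.toReal_mono hY.2.ne h1
  rwa [eLpNorm_one_eq_lintegral_enorm, ← integral_norm_eq_lintegral_enorm hY.1] at h2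

theorem norm_integral_cexp_sub_le {Y Z : Ω → ℝ} (hY : MemLp Y 2 P) (hZ : MemLp Z 2 P) :
    ‖(∫ ω, Complex.exp (Complex.I * Y ω) ∂P) - ∫ ω, Complex.exp (Complex.I * Z ω) ∂P‖ ≤
      (eLpNorm (Y - Z) 2 P).toReal := by
  rw [← integral_sub (integrable_cexp hY.1) (integrable_cexp hZ.1)]
  refine le_trans ?_ (integral_abs_le_eLpNorm_two (hY.sub hZ))
  refine norm_integral_le_of_norm_le ((hY.sub hZ).integrable (by norm_num)).abs
    (ae_of_all _ fun ω => ?_)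
  have e : Complex.exp (Complex.I * Y ω) - Complex.exp (Complex.I * Z ω) =
      Complex.exp (Z ω * Complex.I) * (Complex.exp (Complex.I * ((Y ω - Z ω : ℝ) : ℂ)) - 1) := by
    rw [mul_sub, ← Complex.exp_add, mul_one, mul_comm Complex.I (Z ω : ℂ)]
    congr 2
    push_cast
    ring
  rw [e, norm_mul, Complex.norm_exp_ofReal_mul_I, one_mul]
  simpa using Real.norm_exp_I_mul_ofReal_sub_one_le (x := Y ω - Z ω)

theorem one_sub_le_norm_integral_cexp {Y : Ω → ℝ} (hY : MemLp Y 2 P) :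
    1 - (∫ ω, Y ω ^ 2 ∂P) / 2 ≤ ‖∫ ω, Complex.exp (Complex.I * Y ω) ∂P‖ := by
  refine le_trans ?_ (Complex.re_le_norm _)
  have e : (∫ ω, Complex.exp (Complex.I * Y ω) ∂P).re = ∫ ω, Real.cos (Y ω) ∂P := by
    rw [← Complex.reCLM_apply, ← ContinuousLinearMap.integral_comp_comm _ (integrable_cexp hY.1)]
    refine integral_congr_ae (ae_of_all _ fun ω => ?_)
    simp only [Complex.reCLM_apply]
    rw [mul_comm, Complex.exp_ofReal_mul_I_re]
  rw [e]
  have hi : Integrable (fun ω => Real.cos (Y ω)) P :=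
    Integrable.of_bound (C := 1) (Real.continuous_cos.comp_aestronglyMeasurable hY.1)
      (ae_of_all _ fun ω => by simpa using Real.abs_cos_le_one _)
  calc 1 - (∫ ω, Y ω ^ 2 ∂P) / 2 = ∫ ω, (1 - Y ω ^ 2 / 2) ∂P := by
        rw [integral_sub (integrable_const _) (hY.integrable_sq.div_const 2), integral_div]
        simp
    _ ≤ _ := integral_mono ((integrable_const _).sub (hY.integrable_sq.div_const 2)) hi
        fun ω => Real.one_sub_sq_div_two_le_cos

end Expectation

/-- The rescaling `f ↦ r^{1+d/2} f(a + r ·)` of test functions. -/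
def scl {d : ℕ} (a : Euc d) (r : ℝ) (f : Euc d → ℝ) : Euc d → ℝ :=
  r ^ (1 + (d : ℝ) / 2) • fun x => f (a + r • x)

theorem scl_add {d : ℕ} (a : Euc d) (r : ℝ) (f g : Euc d → ℝ) :
    scl a r (f + g) = scl a r f + scl a r g := by
  ext x; simp [scl, mul_add]

theorem IsTestFun.scl {d : ℕ} {f : Euc d → ℝ} (hf : IsTestFun f) (a : Euc d) {r : ℝ}
    (hr : 0 < r) : IsTestFun (scl a r f) := (hf.comp_affine a hr).smul _

namespace GFF

variable {d : ℕ} {Ω : Type} [MeasurableSpace Ω] (X : GFF d Ω)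

/-- The characteristic functional of the field in the unit ball. -/
def c (f : Euc d → ℝ) : ℂ := ∫ ω, Complex.exp (Complex.I * X.h 0 1 f ω) ∂X.P

/-- The `L²` seminorm on test functions given by the covariance of the field. -/
def N (f : Euc d → ℝ) : ℝ := (eLpNorm (X.h 0 1 f) 2 X.P).toReal

variable {X} {f g : Euc d → ℝ}

theorem memLp_h (hf : IsTestFun f) : MemLp (X.h 0 1 f) 2 X.P := by
  have h4 := X.mom4 f hf
  rw [memLp_two_iff_integrable_sq (X.meas_h 0 1 f).aestronglyMeasurable]
  refine ((integrable_const (1 : ℝ)).add h4).mono'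
    ((X.meas_h 0 1 f).pow_const 2).aestronglyMeasurable (ae_of_all _ fun ω => ?_)
  simp only [Pi.add_apply, Real.norm_eq_abs, abs_of_nonneg (sq_nonneg (X.h 0 1 f ω))]
  nlinarith [sq_nonneg (X.h 0 1 f ω ^ 2 - 1), sq_nonneg (X.h 0 1 f ω), sq_nonneg (X.h 0 1 f ω ^ 2)]

theorem toReal_eLpNorm_sq {Y : Ω → ℝ} (hY : MemLp Y 2 X.P) :
    (eLpNorm Y 2 X.P).toReal ^ 2 = ∫ ω, Y ω ^ 2 ∂X.P := by
  have h := hY.eLpNorm_eq_integral_rpow_norm (by norm_num) (by norm_num)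
  rw [h, ENNReal.toReal_ofReal (by positivity)]
  simp only [ENNReal.toReal_ofNat, Real.rpow_ofNat, Real.norm_eq_abs, sq_abs]
  rw [← Real.rpow_natCast, ← Real.rpow_mul (integral_nonneg fun _ => sq_nonneg _)]
  norm_num

theorem N_sq (hf : IsTestFun f) : X.N f ^ 2 = ∫ ω, X.h 0 1 f ω ^ 2 ∂X.P :=
  toReal_eLpNorm_sq (memLp_h hf)

theorem N_nonneg : 0 ≤ X.N f := ENNReal.toReal_nonneg

theorem N_add_le (hf : IsTestFun f) (hg : IsTestFun g) : X.N (f + g) ≤ X.N f + X.N g := by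
  have e : X.h 0 1 (f + g) =ᵐ[X.P] X.h 0 1 f + X.h 0 1 g := X.lin_add f g hf hg
  rw [N, eLpNorm_congr_ae e, N, N,
    ← ENNReal.toReal_add (memLp_h hf).2.ne (memLp_h hg).2.ne]
  exact ENNReal.toReal_mono (ENNReal.add_ne_top.2 ⟨(memLp_h hf).2.ne, (memLp_h hg).2.ne⟩)
    (eLpNorm_add_le (memLp_h hf).1 (memLp_h hg).1 (by norm_num))

theorem N_smul (a : ℝ) (hf : IsTestFun f) : X.N (a • f) = |a| * X.N f := by
  have e : X.h 0 1 (a • f) =ᵐ[X.P] a • X.h 0 1 f := X.lin_smul a f hf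
  rw [N, eLpNorm_congr_ae e, eLpNorm_const_smul, ENNReal.toReal_mul]
  simp [N]

theorem N_zero : X.N 0 = 0 := by
  have := N_smul (X := X) 0 (isTestFun_zero (d := d))
  simpa using this

theorem N_neg (hf : IsTestFun f) : X.N (-f) = X.N f := by
  have := N_smul (X := X) (-1) hf
  simpa using this

theorem h_sub (hf : IsTestFun f) (hg : IsTestFun g) :
    X.h 0 1 (f - g) =ᵐ[X.P] X.h 0 1 f - X.h 0 1 g := by
  have h1 := X.lin_add f (-g) hf hg.neg
  have h2 := X.lin_smul (-1) g hg
  rw [neg_one_smul] at h2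
  rw [sub_eq_add_neg]
  filter_upwards [h1, h2] with ω e1 e2
  rw [e1, e2, Pi.sub_apply]
  ring

theorem N_sub_le (hf : IsTestFun f) (hg : IsTestFun g) : X.N (f - g) ≤ X.N f + X.N g := by
  rw [sub_eq_add_neg, ← N_neg hg]
  exact N_add_le hf hg.neg

theorem N_sub_comm (hf : IsTestFun f) (hg : IsTestFun g) : X.N (f - g) = X.N (g - f) := by
  rw [← neg_sub, N_neg (hg.sub hf)]

theorem abs_N_sub_N_le (hf : IsTestFun f) (hg : IsTestFun g) :
    |X.N f - X.N g| ≤ X.N (f - g) := by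
  rw [abs_sub_le_iff]
  constructor
  · have := N_add_le (X := X) (hf.sub hg) hg
    rw [sub_add_cancel] at this
    linarith
  · have := N_add_le (X := X) (hg.sub hf) hf
    rw [sub_add_cancel, N_sub_comm hg hf] at this
    linarith

/-- The field only depends on the restriction of the test function to the unit ball. -/
theorem h_congr (hf : IsTestFun f) (hg : IsTestFun g) (h : EqOn f g (ball 0 1)) :
    X.h 0 1 f =ᵐ[X.P] X.h 0 1 g := by
  have h0 := X.zero_outside (f - g) (hf.sub hg) (by
    refine closure_minimal (fun x hx hxb => hx ?_) isOpen_ball.isClosed_compl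
    rw [Pi.sub_apply, h hxb, sub_self])
  filter_upwards [h0, h_sub hf hg] with ω e1 e2
  rw [e2, Pi.sub_apply] at e1
  linarith

theorem N_congr (hf : IsTestFun f) (hg : IsTestFun g) (h : EqOn f g (ball 0 1)) :
    X.N f = X.N g := by
  rw [N, N, eLpNorm_congr_ae (h_congr hf hg h)]

theorem c_congr (hf : IsTestFun f) (hg : IsTestFun g) (h : EqOn f g (ball 0 1)) :
    X.c f = X.c g := by
  refine integral_congr_ae ?_
  filter_upwards [h_congr (X := X) hf hg h] with ω e
  rw [e]

theorem c_zero : X.c 0 = 1 := by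
  have h := X.lin_smul 0 0 isTestFun_zero
  rw [zero_smul] at h
  have : X.c 0 = ∫ ω, (1 : ℂ) ∂X.P := by
    refine integral_congr_ae ?_
    filter_upwards [h] with ω e
    rw [zero_mul] at e
    simp [e]
  simpa using this

theorem norm_c_le_one : ‖X.c f‖ ≤ 1 := norm_integral_cexp_le_one _

theorem norm_c_sub_le (hf : IsTestFun f) (hg : IsTestFun g) :
    ‖X.c f - X.c g‖ ≤ X.N (f - g) := by
  rw [N, eLpNorm_congr_ae (h_sub hf hg)]
  exact norm_integral_cexp_sub_le (memLp_h hf) (memLp_h hg)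

/-! ### The domain Markov property -/

theorem map_H (a : Euc d) {r : ℝ} (hr : 0 < r) (hb : ball a r ⊆ ball (0 : Euc d) 1) {k : ℕ}
    {f : Fin k → Euc d → ℝ} (hf : ∀ i, IsTestFun (f i)) :
    Measure.map (fun ω i => X.H a r (f i) ω) X.P =
      Measure.map (fun ω i => X.h 0 1 (scl a r (f i)) ω) X.P := by
  have hs := X.scaling a r hr k (fun i x => f i (a + r • x)) fun i => (hf i).comp_affine a hr
  rw [X.dmp_law a r hr hb k f hf]
  have e : (fun ω (i : Fin k) => X.h a r (f i) ω) =
      fun ω (i : Fin k) => X.h a r (fun x => f i (a + r • (r⁻¹ • (x - a)))) ω := by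
    ext ω i
    congr 1
    ext x
    rw [smul_inv_smul₀ hr.ne', add_sub_cancel]
  rw [e, hs]
  refine Measure.map_congr ?_
  have : ∀ᵐ ω ∂X.P, ∀ i, X.h 0 1 (scl a r (f i)) ω =
      r ^ (1 + (d : ℝ) / 2) * X.h 0 1 (fun x => f i (a + r • x)) ω :=
    ae_all_iff.2 fun i => X.lin_smul _ _ ((hf i).comp_affine a hr)
  filter_upwards [this] with ω hω
  ext i
  exact (hω i).symm

variable {a : Euc d} {r : ℝ}

theorem identDistrib_H (hr : 0 < r) (hb : ball a r ⊆ ball (0 : Euc d) 1) (hf : IsTestFun f) :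
    IdentDistrib (X.H a r f) (X.h 0 1 (scl a r f)) X.P X.P := by
  have h := map_H (X := X) a hr hb (k := 1) (f := fun _ => f) fun _ => hf
  have h1 : IdentDistrib (fun ω (_ : Fin 1) => X.H a r f ω)
      (fun ω (_ : Fin 1) => X.h 0 1 (scl a r f) ω) X.P X.P :=
    ⟨(measurable_pi_lambda _ fun _ => X.meas_H a r f).aemeasurable,
      (measurable_pi_lambda _ fun _ => X.meas_h 0 1 _).aemeasurable, h⟩
  exact h1.comp (measurable_pi_apply 0)

theorem H_add (hr : 0 < r) (hb : ball a r ⊆ ball (0 : Euc d) 1) (hf : IsTestFun f)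
    (hg : IsTestFun g) : X.H a r (f + g) =ᵐ[X.P] X.H a r f + X.H a r g := by
  have hF : ∀ i, IsTestFun ((![f, g, f + g] : Fin 3 → Euc d → ℝ) i) := by
    intro i
    fin_cases i
    exacts [hf, hg, hf.add hg]
  have h := map_H (X := X) a hr hb hF
  have hms : MeasurableSet {v : Fin 3 → ℝ | v 2 = v 0 + v 1} :=
    measurableSet_eq_fun (by fun_prop) (by fun_prop)
  have hm1 : AEMeasurable (fun ω i => X.H a r ((![f, g, f + g] : Fin 3 → Euc d → ℝ) i) ω) X.P :=
    (measurable_pi_lambda _ fun _ => X.meas_H a r _).aemeasurable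
  have hm2 : AEMeasurable
      (fun ω i => X.h 0 1 (scl a r ((![f, g, f + g] : Fin 3 → Euc d → ℝ) i)) ω) X.P :=
    (measurable_pi_lambda _ fun _ => X.meas_h 0 1 _).aemeasurable
  have h2 : ∀ᵐ ω ∂X.P, X.h 0 1 (scl a r (f + g)) ω =
      X.h 0 1 (scl a r f) ω + X.h 0 1 (scl a r g) ω := by
    rw [scl_add]
    exact X.lin_add _ _ (hf.scl a hr) (hg.scl a hr)
  have h3 := (ae_map_iff hm2 hms).2 h2
  rw [← h] at h3
  exact (ae_map_iff hm1 hms).1 h3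

theorem Φ_add (hr : 0 < r) (hb : ball a r ⊆ ball (0 : Euc d) 1) (hf : IsTestFun f)
    (hg : IsTestFun g) : X.Φ a r (f + g) =ᵐ[X.P] X.Φ a r f + X.Φ a r g := by
  filter_upwards [H_add (X := X) hr hb hf hg, X.lin_add f g hf hg,
    X.dmp_decomp a r hr hb f hf, X.dmp_decomp a r hr hb g hg,
    X.dmp_decomp a r hr hb _ (hf.add hg)] with ω e1 e2 e3 e4 e5
  simp only [Pi.add_apply] at *
  linarith

theorem Φ_lap (hr : 0 < r) (hb : ball a r ⊆ ball (0 : Euc d) 1) (hg : IsTestFun g)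
    (hgs : tsupport g ⊆ ball a r) : X.Φ a r (lap g) =ᵐ[X.P] 0 := by
  filter_upwards [X.dmp_harm a r hr hb] with ω hω
  have hs : tsupport (lap g) ⊆ ball a r := by
    refine (closure_minimal (fun x hx => ?_) (isClosed_tsupport g)).trans hgs
    by_contra hxs
    exact hx (lap_eq_zero_of_notMem_tsupport hxs)
  rw [hω.2 _ hg.lap hs]
  exact integral_harmonic_mul_lap hω.1 hg hgs

theorem indepFun_H_Φ (hr : 0 < r) (hb : ball a r ⊆ ball (0 : Euc d) 1) (hf : IsTestFun f) :
    IndepFun (X.H a r f) (X.Φ a r f) X.P := by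
  have h := X.dmp_indep a r hr hb
  rw [IndepFun_iff_Indep]
  refine indep_of_indep_of_le_left (indep_of_indep_of_le_right h ?_) ?_
  · exact le_sup_of_le_left (le_iSup_of_le ⟨f, hf⟩ le_rfl)
  · exact le_iSup_of_le ⟨f, hf⟩ le_rfl

theorem memLp_H (hr : 0 < r) (hb : ball a r ⊆ ball (0 : Euc d) 1) (hf : IsTestFun f) :
    MemLp (X.H a r f) 2 X.P :=
  (identDistrib_H hr hb hf).memLp_iff.2 (memLp_h (hf.scl a hr))

theorem memLp_Φ (hr : 0 < r) (hb : ball a r ⊆ ball (0 : Euc d) 1) (hf : IsTestFun f) :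
    MemLp (X.Φ a r f) 2 X.P := by
  refine ((memLp_h (X := X) hf).sub (memLp_H hr hb hf)).ae_eq ?_
  filter_upwards [X.dmp_decomp a r hr hb f hf] with ω e
  simp [e]

/-- The second moments of the two parts of the domain Markov decomposition add up. -/
theorem N_sq_eq (hr : 0 < r) (hb : ball a r ⊆ ball (0 : Euc d) 1) (hf : IsTestFun f) :
    X.N f ^ 2 = X.N (scl a r f) ^ 2 + ∫ ω, X.Φ a r f ω ^ 2 ∂X.P := by
  have hH := memLp_H (X := X) hr hb hf
  have hΦ := memLp_Φ (X := X) hr hb hf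
  have hid := identDistrib_H (X := X) hr hb hf
  have h1 : ∫ ω, X.H a r f ω ∂X.P = 0 := by
    rw [hid.integral_eq, X.centered _ _ _ (hf.scl a hr)]
  have h2 : ∫ ω, X.H a r f ω * X.Φ a r f ω ∂X.P = 0 := by
    have := (indepFun_H_Φ (X := X) hr hb hf).integral_mul_eq_mul_integral hH.1 hΦ.1
    rw [h1, zero_mul] at this
    exact this
  have h3 : ∫ ω, X.H a r f ω ^ 2 ∂X.P = X.N (scl a r f) ^ 2 := by
    rw [N_sq (hf.scl a hr)]
    exact (hid.comp (measurable_id.pow_const 2)).integral_eq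
  rw [N_sq hf, ← h3, ← integral_add hH.integrable_sq hΦ.integrable_sq]
  have hi : Integrable (fun ω => X.H a r f ω * X.Φ a r f ω) X.P := hH.integrable_mul hΦ
  calc ∫ ω, X.h 0 1 f ω ^ 2 ∂X.P
      = ∫ ω, ((X.H a r f ω ^ 2 + X.Φ a r f ω ^ 2) + 2 * (X.H a r f ω * X.Φ a r f ω)) ∂X.P := by
        refine integral_congr_ae ?_
        filter_upwards [X.dmp_decomp a r hr hb f hf] with ω e
        rw [e]; ring
    _ = _ := by
        refine (integral_add (hH.integrable_sq.add hΦ.integrable_sq) (hi.const_mul 2)).trans ?_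
        rw [integral_const_mul, h2, mul_zero, add_zero]
        rfl

variable (X) in
/-- The characteristic functional of the harmonic part. -/
def β (a : Euc d) (r : ℝ) (f : Euc d → ℝ) : ℂ :=
  ∫ ω, Complex.exp (Complex.I * X.Φ a r f ω) ∂X.P

theorem c_eq_mul_β (hr : 0 < r) (hb : ball a r ⊆ ball (0 : Euc d) 1) (hf : IsTestFun f) :
    X.c f = X.c (scl a r f) * X.β a r f := by
  have hcont : Continuous fun t : ℝ => Complex.exp (Complex.I * t) := by fun_prop
  have h1 : X.c (scl a r f) = ∫ ω, Complex.exp (Complex.I * X.H a r f ω) ∂X.P :=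
    ((identDistrib_H (X := X) hr hb hf).comp hcont.measurable).integral_eq.symm
  have h2 := ((indepFun_H_Φ (X := X) hr hb hf).comp hcont.measurable
    hcont.measurable).integral_mul_eq_mul_integral
    (hcont.measurable.comp (X.meas_H a r f)).aestronglyMeasurable
    (hcont.measurable.comp (X.meas_Φ a r f)).aestronglyMeasurable
  rw [h1, β]
  refine Eq.trans ?_ h2
  refine integral_congr_ae ?_
  filter_upwards [X.dmp_decomp a r hr hb f hf] with ω e
  simp only [Pi.mul_apply, Function.comp_apply]
  rw [e, ← Complex.exp_add]
  push_cast
  ring_nf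

theorem norm_β_le_one : ‖X.β a r f‖ ≤ 1 := norm_integral_cexp_le_one _

theorem norm_β_sub_le (hr : 0 < r) (hb : ball a r ⊆ ball (0 : Euc d) 1) (hf : IsTestFun f)
    (hg : IsTestFun g) : ‖X.β a r f - X.β a r g‖ ≤ X.N (f - g) := by
  refine (norm_integral_cexp_sub_le (memLp_Φ hr hb hf) (memLp_Φ hr hb hg)).trans ?_
  have e : X.Φ a r f - X.Φ a r g =ᵐ[X.P] X.Φ a r (f - g) := by
    have := Φ_add (X := X) hr hb (hf.sub hg) hg
    rw [sub_add_cancel] at this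
    filter_upwards [this] with ω e
    simp [e]
  rw [eLpNorm_congr_ae e]
  have h1 := N_sq_eq (X := X) hr hb (hf.sub hg)
  rw [← toReal_eLpNorm_sq (memLp_Φ hr hb (hf.sub hg))] at h1
  exact le_of_sq_le_sq (by nlinarith [sq_nonneg (X.N (scl a r (f - g)))]) N_nonneg

theorem β_add_lap (hr : 0 < r) (hb : ball a r ⊆ ball (0 : Euc d) 1) (hf : IsTestFun f)
    (hg : IsTestFun g) (hgs : tsupport g ⊆ ball a r) : X.β a r (f + lap g) = X.β a r f := by
  refine integral_congr_ae ?_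
  filter_upwards [Φ_add (X := X) hr hb hf hg.lap, Φ_lap (X := X) hr hb hg hgs] with ω e1 e2
  rw [e1, Pi.add_apply, e2]
  simp

theorem one_sub_le_norm_β (hr : 0 < r) (hb : ball a r ⊆ ball (0 : Euc d) 1) (hf : IsTestFun f) :
    1 - (X.N f ^ 2 - X.N (scl a r f) ^ 2) / 2 ≤ ‖X.β a r f‖ := by
  have := one_sub_le_norm_integral_cexp (memLp_Φ (X := X) hr hb hf)
  rw [N_sq_eq (X := X) hr hb hf]
  simpa [β] using this

end GFF

/-! ### The zero boundary condition for thin layers -/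

/-- A smooth radial cutoff: `1` where `‖x‖ ≤ a`, `0` where `b ≤ ‖x‖`. -/
def radialCutoff {d : ℕ} (a b : ℝ) (x : Euc d) : ℝ :=
  Real.smoothTransition ((b ^ 2 - ‖x‖ ^ 2) / (b ^ 2 - a ^ 2))

section radialCutoff

variable {d : ℕ} {a b : ℝ} {x y : Euc d}

theorem contDiff_radialCutoff : ContDiff ℝ (⊤ : ℕ∞) (radialCutoff a b : Euc d → ℝ) :=
  Real.smoothTransition.contDiff.comp
    ((contDiff_const.sub (contDiff_norm_sq ℝ)).div_const _)

theorem radialCutoff_nonneg : 0 ≤ radialCutoff a b x := Real.smoothTransition.nonneg _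

theorem radialCutoff_le_one : radialCutoff a b x ≤ 1 := Real.smoothTransition.le_one _

theorem radialCutoff_eq_one (ha : 0 ≤ a) (hab : a < b) (hx : ‖x‖ ≤ a) :
    radialCutoff a b x = 1 := by
  refine Real.smoothTransition.one_of_one_le ?_
  rw [one_le_div (by nlinarith)]
  nlinarith [norm_nonneg x]

theorem radialCutoff_eq_zero (ha : 0 ≤ a) (hab : a < b) (hx : b ≤ ‖x‖) :
    radialCutoff a b x = 0 := by
  refine Real.smoothTransition.zero_of_nonpos ?_
  exact div_nonpos_of_nonpos_of_nonneg (by nlinarith) (by nlinarith)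

theorem radialCutoff_congr (h : ‖x‖ = ‖y‖) : radialCutoff a b x = radialCutoff a b y := by
  rw [radialCutoff, radialCutoff, h]

theorem isTestFun_radialCutoff (ha : 0 ≤ a) (hab : a < b) :
    IsTestFun (radialCutoff a b : Euc d → ℝ) := by
  refine ⟨contDiff_radialCutoff, HasCompactSupport.intro (isCompact_closedBall 0 b) fun x hx => ?_⟩
  rw [mem_closedBall_zero_iff, not_le] at hx
  exact radialCutoff_eq_zero ha hab hx.le

end radialCutoff

theorem exists_norm_eq_one_euc {d : ℕ} (hd : 2 ≤ d) : ∃ v : Euc d, ‖v‖ = 1 :=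
  ⟨EuclideanSpace.single ⟨0, by omega⟩ 1, by simp⟩

theorem volume_annulus_le {d : ℕ} {δ : ℝ} (hδ : 0 < δ) (hδ1 : δ < 1 / 4) :
    (volume (ball (0 : Euc d) (1 + 3 * δ) \ ball 0 (1 - 3 * δ))).toReal ≤
      (volume (ball (0 : Euc d) 1)).toReal * (d * 2 ^ (d - 1) * (6 * δ)) := by
  have h1 : volume.real (ball (0 : Euc d) (1 + 3 * δ) \ ball 0 (1 - 3 * δ)) =
      volume.real (ball (0 : Euc d) (1 + 3 * δ)) - volume.real (ball (0 : Euc d) (1 - 3 * δ)) :=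
    measureReal_sdiff (ball_subset_ball (by linarith)) measurableSet_ball
  have h2 : ∀ ρ : ℝ, 0 < ρ → volume.real (ball (0 : Euc d) ρ) =
      ρ ^ d * volume.real (ball (0 : Euc d) 1) := by
    intro ρ hρ
    rw [measureReal_def, Measure.addHaar_ball_of_pos _ _ hρ, ENNReal.toReal_mul,
      ENNReal.toReal_ofReal (by positivity), measureReal_def]
    simp
  rw [← measureReal_def, h1, h2 (1 + 3 * δ) (by linarith), h2 (1 - 3 * δ) (by linarith),
    ← sub_mul, mul_comm,
    measureReal_def]
  refine mul_le_mul_of_nonneg_left ?_ ENNReal.toReal_nonneg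
  refine (le_abs_self _).trans ((abs_pow_sub_pow_le _ _ _).trans ?_)
  have e1 : |1 + 3 * δ - (1 - 3 * δ)| = 6 * δ := by
    rw [abs_of_nonneg (by linarith)]; ring
  have e2 : max |1 + 3 * δ| |1 - 3 * δ| ≤ 2 :=
    max_le (abs_le.2 ⟨by linarith, by linarith⟩) (abs_le.2 ⟨by linarith, by linarith⟩)
  rw [e1]
  calc 6 * δ * d * max |1 + 3 * δ| |1 - 3 * δ| ^ (d - 1) ≤ 6 * δ * d * 2 ^ (d - 1) := by gcongr
    _ = _ := by ring

namespace GFF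

variable {d : ℕ} {Ω : Type} [MeasurableSpace Ω] {X : GFF d Ω}

theorem tendsto_N_of_annulus (hd : 2 ≤ d) {δ : ℕ → ℝ} (hδ : ∀ n, 0 < δ n)
    (hδ4 : ∀ n, δ n < 1 / 4) (hδ0 : Tendsto δ atTop (𝓝 0)) {f : ℕ → Euc d → ℝ} {M : ℝ}
    (hf : ∀ n, IsTestFun (f n)) (h0 : ∀ n x, 0 ≤ f n x) (hM : ∀ n x, f n x ≤ M / δ n)
    (hs : ∀ n x, f n x ≠ 0 → x ∈ ball (0 : Euc d) (1 + 3 * δ n) \ ball 0 (1 - 3 * δ n))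
    (hp : ∀ n x, ‖x‖ = 1 → f n x ≠ 0)
    (hc : ∀ n x y, ‖x‖ = ‖y‖ → f n x ≤ 3 * f n y) :
    Tendsto (fun n => X.N (f n)) atTop (𝓝 0) := by
  have key := X.zero_bdry f hf h0 ?_ ?_ ⟨3, fun n x y h _ => hc n x y h⟩
  · have h2 : Tendsto (fun n => X.N (f n) ^ 2) atTop (𝓝 0) := by
      refine key.congr fun n => (N_sq (hf n)).symm
    have h3 := (Real.continuous_sqrt.tendsto 0).comp h2
    simpa [Function.comp_def, Real.sqrt_sq N_nonneg] using h3
  · have hM0 : 0 ≤ M := by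
      obtain ⟨v, hv⟩ := exists_norm_eq_one_euc hd
      have := (h0 0 v).trans (hM 0 v)
      by_contra! hneg
      exact absurd this (not_le.2 (div_neg_of_neg_of_pos hneg (hδ 0)))
    refine ⟨M * ((volume (ball (0 : Euc d) 1)).toReal * (d * 2 ^ (d - 1) * 6)), fun n => ?_⟩
    set A := ball (0 : Euc d) (1 + 3 * δ n) \ ball 0 (1 - 3 * δ n) with hA
    have hAm : MeasurableSet A := measurableSet_ball.diff measurableSet_ball
    have hAf : volume A < ⊤ := (measure_mono sdiff_subset).trans_lt measure_ball_lt_top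
    have h1 : ∫ x, f n x ≤ ∫ x, A.indicator (fun _ => M / δ n) x := by
      refine integral_mono ((hf n).1.continuous.integrable_of_hasCompactSupport (hf n).2)
        ((integrable_indicator_iff hAm).2 (integrableOn_const hAf.ne)) fun x => ?_
      by_cases hx : x ∈ A
      · rw [indicator_of_mem hx]; exact hM n x
      · rw [indicator_of_notMem hx]
        exact (not_not.1 fun h => hx (hs n x h)).le
    refine h1.trans ?_
    rw [integral_indicator_const _ hAm, smul_eq_mul, measureReal_def]
    have h2 := volume_annulus_le (d := d) (hδ n) (hδ4 n)
    calc (volume A).toReal * (M / δ n)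
        ≤ (volume (ball (0 : Euc d) 1)).toReal * (d * 2 ^ (d - 1) * (6 * δ n)) * (M / δ n) := by
          have := (hδ n).le
          gcongr
      _ = _ := by have := (hδ n).ne'; field_simp
  · obtain ⟨v, hv⟩ := exists_norm_eq_one_euc hd
    have hl : Tendsto (fun n => 1 - 3 * δ n) atTop (𝓝 1) := by
      simpa using (hδ0.const_mul 3).const_sub 1
    refine tendsto_of_tendsto_of_tendsto_of_le_of_le hl tendsto_const_nhds (fun n => ?_)
      fun n => ?_
    · have hne : (tsupport (f n)).Nonempty := ⟨v, subset_tsupport _ (hp n v hv)⟩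
      refine (le_infDist hne).2 fun y hy => ?_
      rw [dist_zero_left]
      have hcl : tsupport (f n) ⊆ (ball 0 (1 - 3 * δ n))ᶜ :=
        closure_minimal (fun x hx => (hs n x hx).2) isOpen_ball.isClosed_compl
      simpa using hcl hy
    · have := infDist_le_dist_of_mem (x := (0 : Euc d)) (subset_tsupport _ (hp n v hv))
      rwa [dist_zero_left, hv] at this

/-- Test functions concentrated in a layer of width `δ` at the boundary, of size `O(1/δ)`, are
asymptotically negligible. -/
theorem exists_layer_bound (hd : 2 ≤ d) (X : GFF d Ω) (C : ℝ) {ε : ℝ} (hε : 0 < ε) :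
    ∃ δ₀ > 0, ∀ δ, 0 < δ → δ < δ₀ → ∀ e : Euc d → ℝ, IsTestFun e →
      (∀ x, ‖x‖ < 1 → |e x| ≤ C / δ) → (∀ x, ‖x‖ < 1 - δ → e x = 0) → X.N e ≤ ε := by
  by_contra! H
  have H' : ∀ n : ℕ, ∃ δ, 0 < δ ∧ δ < 1 / ((n : ℝ) + 5) ∧ ∃ e : Euc d → ℝ, IsTestFun e ∧
      (∀ x, ‖x‖ < 1 → |e x| ≤ C / δ) ∧ (∀ x, ‖x‖ < 1 - δ → e x = 0) ∧ ε < X.N e :=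
    fun n => H _ (by positivity)
  choose δ hδ hδn e he hb hz hN using H'
  have hδ5 : ∀ n, δ n < 1 / 4 := fun n => (hδn n).trans_le (by
    refine one_div_le_one_div_of_le (by norm_num) ?_
    have : (0 : ℝ) ≤ n := Nat.cast_nonneg n
    linarith)
  have hδ0 : Tendsto δ atTop (𝓝 0) := by
    refine squeeze_zero (fun n => (hδ n).le) (fun n => (hδn n).le) ?_
    simpa using (tendsto_const_nhds (x := (1 : ℝ))).div_atTop
      (tendsto_atTop_add_const_right _ (5 : ℝ) tendsto_natCast_atTop_atTop)
  set A : ℕ → ℝ := fun n => (|C| + 1) / δ n with hA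
  have hA0 : ∀ n, 0 < A n := fun n => div_pos (by positivity) (hδ n)
  have hCA : ∀ n, C / δ n < A n := fun n =>
    div_lt_div_of_pos_right ((le_abs_self C).trans_lt (lt_add_one _)) (hδ n)
  -- bound outside of the ball
  have hρ : ∀ n, ∃ ρ, 1 < ρ ∧ ρ ≤ 1 + δ n ∧ ∀ x, ‖x‖ < ρ → |e n x| ≤ A n := by
    intro n
    have ho : IsOpen {x | |e n x| < A n} :=
      isOpen_lt (he n).1.continuous.abs continuous_const
    have hc : closedBall (0 : Euc d) 1 ⊆ {x | |e n x| ≤ C / δ n} := by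
      rw [← closure_ball (0 : Euc d) one_ne_zero]
      exact closure_minimal (fun x hx => hb n x (by simpa using hx))
        (isClosed_le (he n).1.continuous.abs continuous_const)
    obtain ⟨η, hη, hsub⟩ := (isCompact_closedBall (0 : Euc d) 1).exists_thickening_subset_open ho
      fun x hx => (hc hx).trans_lt (hCA n)
    rw [thickening_closedBall hη zero_le_one] at hsub
    refine ⟨min (1 + η) (1 + δ n), lt_min (by linarith) (by linarith [hδ n]), min_le_right _ _,
      fun x hx => (hsub ?_).le⟩
    rw [mem_ball_zero_iff, add_comm]
    exact hx.trans_le (min_le_left _ _)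
  choose ρ hρ1 hρδ hρb using hρ
  set e' : ℕ → Euc d → ℝ := fun n => radialCutoff 1 (ρ n) * e n with he'
  have het : ∀ n, IsTestFun (e' n) := fun n => IsTestFun.mul_left contDiff_radialCutoff (he n)
  have heb : ∀ n x, |e' n x| ≤ A n := by
    intro n x
    simp only [he', Pi.mul_apply]
    by_cases hx : ‖x‖ < ρ n
    · rw [abs_mul, abs_of_nonneg radialCutoff_nonneg]
      exact (mul_le_of_le_one_left (abs_nonneg _) radialCutoff_le_one).trans (hρb n x hx)
    · rw [radialCutoff_eq_zero zero_le_one (hρ1 n) (not_lt.1 hx)]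
      simpa using (hA0 n).le
  have hes : ∀ n x, e' n x ≠ 0 → 1 - δ n ≤ ‖x‖ ∧ ‖x‖ ≤ 1 + δ n := by
    intro n x hx
    constructor
    · by_contra! h
      exact hx (by simp only [he', Pi.mul_apply, hz n x h, mul_zero])
    · by_contra! h
      exact hx (by
        simp only [he', Pi.mul_apply,
          radialCutoff_eq_zero zero_le_one (hρ1 n) ((hρδ n).trans h.le), zero_mul])
  have heN : ∀ n, X.N (e' n) = X.N (e n) := fun n => N_congr (het n) (he n) fun x hx => by
    simp only [he', Pi.mul_apply]
    rw [radialCutoff_eq_one zero_le_one (hρ1 n) (mem_ball_zero_iff.1 hx).le, one_mul]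
  -- the radial majorant
  set η : ℕ → Euc d → ℝ := fun n =>
    radialCutoff (1 + δ n) (1 + 2 * δ n) * (1 - radialCutoff (1 - 2 * δ n) (1 - δ n)) with hη
  have hηt : ∀ n, IsTestFun (η n) := fun n =>
    (isTestFun_radialCutoff (by linarith [hδ n]) (by linarith [hδ n])).mul_right
      (contDiff_const.sub contDiff_radialCutoff)
  have hη0 : ∀ n x, 0 ≤ η n x := fun n x =>
    mul_nonneg radialCutoff_nonneg (sub_nonneg.2 radialCutoff_le_one)
  have hη1 : ∀ n x, η n x ≤ 1 := fun n x =>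
    mul_le_one₀ radialCutoff_le_one (sub_nonneg.2 radialCutoff_le_one)
      (sub_le_self _ radialCutoff_nonneg)
  have hηc : ∀ n x y, ‖x‖ = ‖y‖ → η n x = η n y := fun n x y h => by
    simp only [hη, Pi.mul_apply, Pi.sub_apply, Pi.one_apply, radialCutoff_congr h]
  have hηe : ∀ n x, 1 - δ n ≤ ‖x‖ → ‖x‖ ≤ 1 + δ n → η n x = 1 := fun n x h1 h2 => by
    have := hδ n
    have := hδ5 n
    simp only [hη, Pi.mul_apply, Pi.sub_apply, Pi.one_apply]
    rw [radialCutoff_eq_one (by linarith) (by linarith) h2,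
      radialCutoff_eq_zero (by linarith) (by linarith) h1]
    norm_num
  have hηs : ∀ n x, η n x ≠ 0 → x ∈ ball (0 : Euc d) (1 + 3 * δ n) \ ball 0 (1 - 3 * δ n) := by
    intro n x hx
    have := hδ n
    have := hδ5 n
    simp only [Set.mem_sdiff, mem_ball_zero_iff, not_lt]
    constructor
    · by_contra! h
      refine hx ?_
      simp only [hη, Pi.mul_apply]
      rw [radialCutoff_eq_zero (by linarith) (by linarith) (by linarith), zero_mul]
    · by_contra! h
      refine hx ?_
      simp only [hη, Pi.mul_apply, Pi.sub_apply, Pi.one_apply]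
      rw [radialCutoff_eq_one (a := 1 - 2 * δ n) (by linarith) (by linarith) (by linarith),
        sub_self, mul_zero]
  have hδA : ∀ n, (2 * (|C| + 1)) / δ n = 2 * A n := fun n => by simp only [hA]; ring
  have T2 : Tendsto (fun n => X.N ((2 * A n) • η n)) atTop (𝓝 0) := by
    refine tendsto_N_of_annulus hd hδ hδ5 hδ0 (M := 2 * (|C| + 1)) (fun n => (hηt n).smul _)
      (fun n x => ?_) (fun n x => ?_) (fun n x hx => hηs n x ?_) (fun n x hx => ?_)
      (fun n x y hxy => ?_)
    · exact mul_nonneg (by linarith [hA0 n]) (hη0 n x)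
    · rw [hδA, Pi.smul_apply, smul_eq_mul]
      exact mul_le_of_le_one_right (by linarith [hA0 n]) (hη1 n x)
    · exact right_ne_zero_of_mul hx
    · rw [Pi.smul_apply, hηe n x (by linarith [hδ n]) (by linarith [hδ n])]
      simpa using (hA0 n).ne'
    · simp only [Pi.smul_apply, smul_eq_mul, hηc n x y hxy]
      nlinarith [mul_nonneg (hA0 n).le (hη0 n y)]
  have T1 : Tendsto (fun n => X.N (e' n + (2 * A n) • η n)) atTop (𝓝 0) := by
    have hv : ∀ n x, 1 - δ n ≤ ‖x‖ → ‖x‖ ≤ 1 + δ n →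
        A n ≤ (e' n + (2 * A n) • η n) x ∧ (e' n + (2 * A n) • η n) x ≤ 3 * A n := by
      intro n x h1 h2
      have := abs_le.1 (heb n x)
      simp only [Pi.add_apply, Pi.smul_apply, smul_eq_mul, hηe n x h1 h2]
      constructor <;> linarith
    have hv' : ∀ n x, ¬ (1 - δ n ≤ ‖x‖ ∧ ‖x‖ ≤ 1 + δ n) →
        (e' n + (2 * A n) • η n) x = 2 * A n * η n x := by
      intro n x h
      have : e' n x = 0 := not_not.1 fun h' => h (hes n x h')
      simp [this]
    refine tendsto_N_of_annulus hd hδ hδ5 hδ0 (M := 3 * (|C| + 1))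
      (fun n => (het n).add ((hηt n).smul _))
      (fun n x => ?_) (fun n x => ?_) (fun n x hx => ?_) (fun n x hx => ?_)
      (fun n x y hxy => ?_)
    · by_cases h : 1 - δ n ≤ ‖x‖ ∧ ‖x‖ ≤ 1 + δ n
      · exact (hA0 n).le.trans (hv n x h.1 h.2).1
      · rw [hv' n x h]
        exact mul_nonneg (by linarith [hA0 n]) (hη0 n x)
    · have e3 : 3 * (|C| + 1) / δ n = 3 * A n := by simp only [hA]; ring
      rw [e3]
      by_cases h : 1 - δ n ≤ ‖x‖ ∧ ‖x‖ ≤ 1 + δ n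
      · exact (hv n x h.1 h.2).2
      · rw [hv' n x h]
        nlinarith [hA0 n, hη1 n x]
    · refine hηs n x fun h0 => hx ?_
      by_cases h : 1 - δ n ≤ ‖x‖ ∧ ‖x‖ ≤ 1 + δ n
      · exact absurd (hηe n x h.1 h.2) (by simp [h0])
      · rw [hv' n x h, h0, mul_zero]
    · exact ((hA0 n).trans_le (hv n x (by linarith [hδ n]) (by linarith [hδ n])).1).ne'
    · by_cases h : 1 - δ n ≤ ‖x‖ ∧ ‖x‖ ≤ 1 + δ n
      · have h1 := (hv n x h.1 h.2).2
        have h2 := (hv n y (hxy ▸ h.1) (hxy ▸ h.2)).1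
        linarith
      · rw [hv' n x h, hv' n y (hxy ▸ h), hηc n x y hxy]
        nlinarith [mul_nonneg (hA0 n).le (hη0 n y)]
  have T := T1.add T2
  rw [add_zero] at T
  obtain ⟨n, hn⟩ := (T.eventually (gt_mem_nhds hε)).exists
  have h1 := N_sub_le (X := X) ((het n).add ((hηt n).smul (2 * A n))) ((hηt n).smul (2 * A n))
  rw [add_sub_cancel_right, heN] at h1
  linarith [hN n]

end GFF

/-! ### Polynomial test functions -/

/-- A polynomial as a function on Euclidean space. -/
def peval {d : ℕ} (p : MvPolynomial (Fin d) ℝ) (x : Euc d) : ℝ :=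
  MvPolynomial.eval (fun i => x i) p

/-- The polynomial `p`, cut off away from the unit ball. -/
def polyTest {d : ℕ} (p : MvPolynomial (Fin d) ℝ) : Euc d → ℝ := radialCutoff 2 3 * peval p

/-- The dilated polynomial `t^{1+d/2} p(t x)`. -/
def dil {d : ℕ} (t : ℝ) (p : MvPolynomial (Fin d) ℝ) : MvPolynomial (Fin d) ℝ :=
  MvPolynomial.C (t ^ (1 + (d : ℝ) / 2)) *
    MvPolynomial.aeval (fun i => MvPolynomial.C t * MvPolynomial.X i) p

section poly

variable {d : ℕ} (p q : MvPolynomial (Fin d) ℝ)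

theorem contDiff_peval {n : WithTop ℕ∞} : ContDiff ℝ n (peval p) := by
  have h : ∀ i : Fin d, ContDiff ℝ n fun x : Euc d => x i := fun i =>
    (EuclideanSpace.proj (𝕜 := ℝ) i).contDiff
  induction p using MvPolynomial.induction_on with
  | C a =>
    have : peval (MvPolynomial.C a : MvPolynomial (Fin d) ℝ) = fun _ => a := by
      ext x; simp [peval]
    rw [this]
    exact contDiff_const
  | add p q hp hq =>
    have : peval (p + q) = fun x => peval p x + peval q x := by ext x; simp [peval]
    rw [this]
    exact hp.add hq
  | mul_X p i hp =>
    have : peval (p * MvPolynomial.X i) = fun x => peval p x * x i := by ext x; simp [peval]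
    rw [this]
    exact hp.mul (h i)

theorem peval_dil (t : ℝ) (x : Euc d) :
    peval (dil t p) x = t ^ (1 + (d : ℝ) / 2) * peval p (t • x) := by
  simp only [peval, dil, map_mul, MvPolynomial.eval_C]
  congr 1
  induction p using MvPolynomial.induction_on with
  | C a => simp
  | add p q hp hq => rw [map_add, map_add, map_add, hp, hq]
  | mul_X p i hp => rw [map_mul, map_mul, map_mul, hp]; simp

theorem isTestFun_polyTest : IsTestFun (polyTest p) :=
  (isTestFun_radialCutoff (by norm_num) (by norm_num)).mul_right (contDiff_peval p)

variable {p q} in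
theorem polyTest_apply {x : Euc d} (hx : ‖x‖ ≤ 2) : polyTest p x = peval p x := by
  rw [polyTest, Pi.mul_apply, radialCutoff_eq_one (by norm_num) (by norm_num) hx, one_mul]

theorem polyTest_add : polyTest (p + q) = polyTest p + polyTest q := by
  ext x; simp [polyTest, peval, mul_add]

theorem polyTest_smul (a : ℝ) : polyTest (a • p) = a • polyTest p := by
  ext x; simp [polyTest, peval, MvPolynomial.smul_eval]; ring

theorem dil_add (t : ℝ) : dil t (p + q) = dil t p + dil t q := by
  simp [dil, mul_add]

theorem dil_smul (t a : ℝ) : dil t (a • p) = a • dil t p := by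
  simp [dil]

theorem dil_zero_left : dil 0 p = 0 := by
  rw [dil, Real.zero_rpow (by positivity)]
  simp

theorem dil_one_left : dil 1 p = p := by
  simp only [dil, Real.one_rpow, MvPolynomial.C_1, one_mul]
  exact MvPolynomial.aeval_X_left_apply p

theorem polyTest_dil_dil {s t : ℝ} (hs : 0 ≤ s) (ht : 0 ≤ t) :
    polyTest (dil s (dil t p)) = polyTest (dil (t * s) p) := by
  ext x
  simp only [polyTest, Pi.mul_apply, peval_dil, Real.mul_rpow ht hs, smul_smul]
  ring

theorem scl_polyTest {r : ℝ} (hr : 0 < r) (hr1 : r ≤ 1) :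
    EqOn (scl 0 r (polyTest p)) (polyTest (dil r p)) (ball 0 1) := by
  intro x hx
  rw [mem_ball_zero_iff] at hx
  have h1 : ‖r • x‖ ≤ 2 := by
    rw [norm_smul, Real.norm_eq_abs, abs_of_pos hr]
    nlinarith [norm_nonneg x]
  rw [polyTest_apply (by linarith), peval_dil, scl]
  simp only [Pi.smul_apply, zero_add, smul_eq_mul]
  rw [polyTest_apply h1]

theorem peval_dil_monomial (m : Fin d →₀ ℕ) (a t : ℝ) (x : Euc d) :
    peval (dil t (MvPolynomial.monomial m a)) x =
      (t ^ (1 + (d : ℝ) / 2) * m.prod fun _ e => t ^ e) *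
        peval (MvPolynomial.monomial m a) x := by
  rw [peval_dil]
  simp only [peval, MvPolynomial.eval_monomial, PiLp.smul_apply, smul_eq_mul, mul_pow,
    Finsupp.prod_mul]
  ring

end poly

namespace GFF

variable {d : ℕ} {Ω : Type} [MeasurableSpace Ω] {X : GFF d Ω}

theorem tendsto_N_polyTest_dil_sub (p : MvPolynomial (Fin d) ℝ) (t₀ : ℝ) :
    Tendsto (fun t => X.N (polyTest (dil t p) - polyTest (dil t₀ p))) (𝓝 t₀) (𝓝 0) := by
  induction p using MvPolynomial.induction_on' with
  | monomial m a =>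
    set τ : ℝ → ℝ := fun t => t ^ (1 + (d : ℝ) / 2) * m.prod fun _ e => t ^ e with hτ
    have hτc : Continuous τ :=
      (Real.continuous_rpow_const (by positivity)).mul
        (continuous_finsetProd _ fun i _ => continuous_pow _)
    have e : ∀ t, polyTest (dil t (MvPolynomial.monomial m a)) =
        τ t • polyTest (MvPolynomial.monomial m a) := by
      intro t
      ext x
      simp only [polyTest, Pi.mul_apply, peval_dil_monomial, Pi.smul_apply, smul_eq_mul, hτ]
      ring
    have h : Tendsto (fun t => |τ t - τ t₀| * X.N (polyTest (MvPolynomial.monomial m a))) (𝓝 t₀)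
        (𝓝 (|τ t₀ - τ t₀| * X.N (polyTest (MvPolynomial.monomial m a)))) :=
      ((hτc.sub continuous_const).abs.mul continuous_const).tendsto t₀
    simp only [sub_self, abs_zero, zero_mul] at h
    refine h.congr fun t => ?_
    rw [e, e, ← sub_smul, N_smul _ (isTestFun_polyTest _)]
  | add p q hp hq =>
    have h := hp.add hq
    rw [add_zero] at h
    refine squeeze_zero (fun _ => N_nonneg) (fun t => ?_) h
    rw [dil_add, dil_add, polyTest_add, polyTest_add, add_sub_add_comm]
    exact N_add_le ((isTestFun_polyTest _).sub (isTestFun_polyTest _))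
      ((isTestFun_polyTest _).sub (isTestFun_polyTest _))

theorem continuous_N_polyTest_dil (p : MvPolynomial (Fin d) ℝ) :
    Continuous fun t => X.N (polyTest (dil t p)) := by
  refine continuous_iff_continuousAt.2 fun t₀ => ?_
  rw [ContinuousAt, tendsto_iff_norm_sub_tendsto_zero]
  exact squeeze_zero (fun _ => norm_nonneg _)
    (fun t => abs_N_sub_N_le (isTestFun_polyTest _) (isTestFun_polyTest _))
    (tendsto_N_polyTest_dil_sub p t₀)

theorem continuous_c_smul_polyTest_dil (p : MvPolynomial (Fin d) ℝ) (a : ℝ) :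
    Continuous fun t => X.c (a • polyTest (dil t p)) := by
  refine continuous_iff_continuousAt.2 fun t₀ => ?_
  rw [ContinuousAt, tendsto_iff_norm_sub_tendsto_zero]
  have h := tendsto_N_polyTest_dil_sub (X := X) (a • p) t₀
  simp only [dil_smul, polyTest_smul] at h
  exact squeeze_zero (fun _ => norm_nonneg _)
    (fun t => norm_c_sub_le ((isTestFun_polyTest _).smul a) ((isTestFun_polyTest _).smul a)) h

theorem ball_subset_of_le {d : ℕ} {r : ℝ} (hr1 : r ≤ 1) :
    ball (0 : Euc d) r ⊆ ball (0 : Euc d) 1 := ball_subset_ball hr1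

theorem c_polyTest_eq {r : ℝ} (hr : 0 < r) (hr1 : r ≤ 1) (p : MvPolynomial (Fin d) ℝ) :
    X.c (polyTest p) = X.c (polyTest (dil r p)) * X.β 0 r (polyTest p) := by
  rw [c_eq_mul_β hr (ball_subset_of_le hr1) (isTestFun_polyTest p),
    c_congr ((isTestFun_polyTest p).scl 0 hr) (isTestFun_polyTest _) (scl_polyTest p hr hr1)]

/-- The characteristic functional does not vanish at polynomials. -/
theorem exp_neg_le_norm_c_polyTest (p : MvPolynomial (Fin d) ℝ) :
    Real.exp (-X.N (polyTest p) ^ 2) ≤ ‖X.c (polyTest p)‖ := by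
  set v : ℝ → ℝ := fun t => X.N (polyTest (dil t p)) ^ 2 with hv
  have hvc : Continuous v := (continuous_N_polyTest_dil p).pow 2
  have hu := (isCompact_Icc (a := (0 : ℝ)) (b := 1)).uniformContinuousOn_of_continuous
    hvc.continuousOn
  obtain ⟨δ, hδ, hu⟩ := Metric.uniformContinuousOn_iff_le.1 hu 1 one_pos
  obtain ⟨r, hr0, hr1, hrδ⟩ : ∃ r : ℝ, 0 < r ∧ r < 1 ∧ 1 - r ≤ δ := by
    refine ⟨max (1 / 2) (1 - δ / 2), by positivity, max_lt (by norm_num) (by linarith), ?_⟩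
    have := le_max_right (1 / 2 : ℝ) (1 - δ / 2)
    linarith
  have hpow : ∀ k : ℕ, r ^ k ∈ Icc (0 : ℝ) 1 := fun k =>
    ⟨by positivity, pow_le_one₀ hr0.le hr1.le⟩
  have hd2 : ∀ k : ℕ, polyTest (dil r (dil (r ^ k) p)) = polyTest (dil (r ^ (k + 1)) p) := by
    intro k
    rw [polyTest_dil_dil _ hr0.le (hpow k).1, pow_succ]
  have step : ∀ k : ℕ, ‖X.c (polyTest (dil (r ^ (k + 1)) p))‖ *
      Real.exp (-(v (r ^ k) - v (r ^ (k + 1)))) ≤ ‖X.c (polyTest (dil (r ^ k) p))‖ := by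
    intro k
    rw [c_polyTest_eq hr0 hr1.le (dil (r ^ k) p), hd2, norm_mul]
    refine mul_le_mul_of_nonneg_left ?_ (norm_nonneg _)
    have ht := isTestFun_polyTest (dil (r ^ k) p)
    have e : X.N (scl 0 r (polyTest (dil (r ^ k) p))) ^ 2 = v (r ^ (k + 1)) := by
      rw [hv, N_congr (ht.scl 0 hr0) (isTestFun_polyTest _) (scl_polyTest _ hr0 hr1.le), hd2]
    refine le_trans ?_ (one_sub_le_norm_β hr0 (ball_subset_of_le hr1.le) ht)
    have h2 := N_sq_eq (X := X) hr0 (ball_subset_of_le hr1.le) ht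
    rw [e] at h2 ⊢
    have hx0 : 0 ≤ v (r ^ k) - v (r ^ (k + 1)) := by
      have : 0 ≤ ∫ ω, X.Φ 0 r (polyTest (dil (r ^ k) p)) ω ^ 2 ∂X.P :=
        integral_nonneg fun _ => sq_nonneg _
      simp only [hv] at h2 ⊢
      linarith
    have hx1 : v (r ^ k) - v (r ^ (k + 1)) ≤ 1 := by
      have := hu _ (hpow k) _ (hpow (k + 1)) (by
        rw [Real.dist_eq, pow_succ, abs_of_nonneg]
        · nlinarith [(hpow k).1, (hpow k).2]
        · nlinarith [(hpow k).1, (hpow k).2])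
      exact (le_abs_self _).trans this
    change _ ≤ 1 - (v (r ^ k) - v (r ^ (k + 1))) / 2
    set x := v (r ^ k) - v (r ^ (k + 1))
    have h3 : Real.exp (-x) * (1 + x) ≤ 1 := by
      have := Real.add_one_le_exp x
      calc Real.exp (-x) * (1 + x) ≤ Real.exp (-x) * Real.exp x := by
            gcongr; linarith
        _ = 1 := by rw [← Real.exp_add]; simp
    have h4 : 1 ≤ (1 - x / 2) * (1 + x) := by nlinarith
    exact le_of_mul_le_mul_right (h3.trans h4) (by linarith)
  have chain : ∀ k : ℕ, ‖X.c (polyTest (dil (r ^ k) p))‖ * Real.exp (-(v 1 - v (r ^ k))) ≤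
      ‖X.c (polyTest p)‖ := by
    intro k
    induction k with
    | zero => simp [dil_one_left]
    | succ k ih =>
      refine le_trans ?_ ih
      have e : Real.exp (-(v 1 - v (r ^ (k + 1)))) =
          Real.exp (-(v (r ^ k) - v (r ^ (k + 1)))) * Real.exp (-(v 1 - v (r ^ k))) := by
        rw [← Real.exp_add]; ring_nf
      rw [e, ← mul_assoc]
      exact mul_le_mul_of_nonneg_right (step k) (Real.exp_pos _).le
  have hlim0 : Tendsto (fun k : ℕ => r ^ k) atTop (𝓝 0) :=
    tendsto_pow_atTop_nhds_zero_of_lt_one hr0.le hr1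
  have hc := (continuous_c_smul_polyTest_dil (X := X) p 1).norm.tendsto 0
  simp only [one_smul] at hc
  have hlim := (hc.comp hlim0).mul
    (((hvc.tendsto 0).comp hlim0).const_sub (v 1)).neg.rexp
  have hpz : polyTest (0 : MvPolynomial (Fin d) ℝ) = 0 := by
    ext x; simp [polyTest, peval]
  have hv0 : v 0 = 0 := by simp [hv, dil_zero_left, hpz, N_zero]
  have hv1 : v 1 = X.N (polyTest p) ^ 2 := by simp [hv, dil_one_left]
  rw [dil_zero_left, hpz, c_zero, hv0, hv1, norm_one, one_mul, sub_zero] at hlim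
  exact le_of_tendsto hlim (Eventually.of_forall fun k => by simpa [hv1] using chain k)

end GFF

/-! ### Polynomial approximation of smooth functions with all derivatives -/

section approx

open ContinuousLinearMap in
/-- Kernels close to a normalised bump function approximate the identity together with all
derivatives. -/
theorem exists_convolution_sub_bound {d : ℕ} (m : ℕ) {E : Type} [NormedAddCommGroup E]
    [NormedSpace ℝ E] [CompleteSpace E] {F : Euc d → E} (hF : ContDiff ℝ (⊤ : ℕ∞) F) {ρ : ℝ}
    (hs : tsupport F ⊆ closedBall 0 ρ) {ε : ℝ} (hε : 0 < ε) :
    ∃ δ > 0, ∀ (k : Euc d → ℝ) (φ : ContDiffBump (0 : Euc d)), Continuous k → φ.rOut ≤ δ →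
      (∀ t, ‖t‖ ≤ 1 + ρ → |k t - φ.normed volume t| ≤ δ) → ∀ x, ‖x‖ ≤ 1 →
      ‖iteratedFDeriv ℝ m (convolution k F (lsmul ℝ ℝ) volume - F) x‖ ≤ ε := by
  induction m generalizing E F ε with
  | zero =>
    have hcs : HasCompactSupport F := HasCompactSupport.of_support_subset_isCompact
      (isCompact_closedBall 0 ρ) ((subset_tsupport F).trans hs)
    have huc : UniformContinuous F := hcs.uniformContinuous_of_continuous hF.continuous
    obtain ⟨δ₁, hδ₁, hu⟩ := Metric.uniformContinuous_iff_le.1 huc (ε / 2) (by positivity)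
    have hI : Integrable F := hF.continuous.integrable_of_hasCompactSupport hcs
    set J := ∫ x, ‖F x‖ with hJ
    have hJ0 : 0 ≤ J := integral_nonneg fun _ => norm_nonneg _
    refine ⟨min δ₁ (ε / 2 / (J + 1)), by positivity, fun k φ hk hφ hkφ x hx => ?_⟩
    rw [norm_iteratedFDeriv_zero, Pi.sub_apply]
    have h1 : ‖convolution (φ.normed volume) F (lsmul ℝ ℝ) volume x - F x‖ ≤ ε / 2 := by
      rw [← dist_eq_norm]
      refine φ.dist_normed_convolution_le hF.continuous.aestronglyMeasurable fun y hy => ?_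
      exact hu (((mem_ball.1 hy).le.trans hφ).trans (min_le_left _ _))
    have hFx : Continuous fun t => F (x - t) := hF.continuous.comp (by fun_prop)
    have hFc : HasCompactSupport fun t => F (x - t) :=
      hcs.comp_homeomorph (Homeomorph.subLeft x)
    have i1 : ∀ {κ : Euc d → ℝ}, Continuous κ → Integrable fun t => κ t • F (x - t) :=
      fun hκ => (hκ.smul hFx).integrable_of_hasCompactSupport hFc.smul_left
    have h2 : ‖convolution k F (lsmul ℝ ℝ) volume x -
        convolution (φ.normed volume) F (lsmul ℝ ℝ) volume x‖ ≤ ε / 2 := by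
      simp only [convolution, lsmul_apply]
      rw [← integral_sub (i1 hk) (i1 φ.continuous_normed)]
      calc ‖∫ t, (k t • F (x - t) - φ.normed volume t • F (x - t))‖
          ≤ ∫ t, ε / 2 / (J + 1) * ‖F (x - t)‖ := by
            refine norm_integral_le_of_norm_le ?_ (ae_of_all _ fun t => ?_)
            · exact ((hI.comp_sub_left x).norm).const_mul _
            · rw [← sub_smul, norm_smul]
              by_cases ht : F (x - t) = 0
              · simp [ht]
              · have h3 : ‖x - t‖ ≤ ρ := by simpa using hs (subset_tsupport F ht)
                have h4 : ‖t‖ ≤ 1 + ρ := by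
                  calc ‖t‖ = ‖x - (x - t)‖ := by simp
                    _ ≤ ‖x‖ + ‖x - t‖ := norm_sub_le _ _
                    _ ≤ 1 + ρ := add_le_add hx h3
                exact mul_le_mul_of_nonneg_right ((hkφ t h4).trans (min_le_right _ _))
                  (norm_nonneg _)
        _ = ε / 2 / (J + 1) * J := by
            rw [integral_const_mul, integral_sub_left_eq_self (fun t => ‖F t‖) volume x]
        _ ≤ ε / 2 := by
            rw [div_mul_eq_mul_div, div_le_iff₀ (by positivity)]
            nlinarith
    calc _ = ‖(convolution k F (lsmul ℝ ℝ) volume x -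
            convolution (φ.normed volume) F (lsmul ℝ ℝ) volume x) +
          (convolution (φ.normed volume) F (lsmul ℝ ℝ) volume x - F x)‖ := by
            rw [sub_add_sub_cancel]
      _ ≤ ε / 2 + ε / 2 := (norm_add_le _ _).trans (add_le_add h2 h1)
      _ = ε := by ring
  | succ m ih =>
    have hcs : HasCompactSupport F := HasCompactSupport.of_support_subset_isCompact
      (isCompact_closedBall 0 ρ) ((subset_tsupport F).trans hs)
    have hF' : ContDiff ℝ (⊤ : ℕ∞) (fderiv ℝ F) := hF.fderiv_right (by simp)
    obtain ⟨δ, hδ, h⟩ := ih hF' ((tsupport_fderiv_subset ℝ).trans hs) hε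
    refine ⟨δ, hδ, fun k φ hk hφ hkφ x hx => ?_⟩
    have hder : ∀ x, HasFDerivAt (convolution k F (lsmul ℝ ℝ) volume)
        (convolution k (fderiv ℝ F) (lsmul ℝ ℝ) volume x) x := by
      intro x
      have := hcs.hasFDerivAt_convolution_right (lsmul ℝ ℝ) (μ := volume)
        hk.locallyIntegrable (hF.of_le (by simp)) x
      have e0 : convolution k (fderiv ℝ F) (precompR (Euc d) (lsmul ℝ ℝ)) volume x =
          convolution k (fderiv ℝ F) (lsmul ℝ ℝ) volume x := by
        simp only [convolution]
        refine integral_congr_ae (ae_of_all _ fun t => ?_)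
        ext v
        simp
      rw [e0] at this
      exact this
    have e : fderiv ℝ (convolution k F (lsmul ℝ ℝ) volume - F) =
        convolution k (fderiv ℝ F) (lsmul ℝ ℝ) volume - fderiv ℝ F := by
      ext1 x
      exact ((hder x).sub (hF.differentiable (by simp) x).hasFDerivAt).fderiv
    rw [← norm_iteratedFDeriv_fderiv, e]
    exact h k φ hk hφ hkφ x hx

theorem exists_peval_eq_integral {d : ℕ} (p : MvPolynomial (Fin d) ℝ) {f : Euc d → ℝ}
    (hf : IsTestFun f) : ∃ q : MvPolynomial (Fin d) ℝ,
      ∀ x, ∫ t, peval p (x - t) * f t = peval q x := by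
  have hInt : ∀ (p : MvPolynomial (Fin d) ℝ) {f : Euc d → ℝ} (_ : IsTestFun f) (x : Euc d),
      Integrable fun t => peval p (x - t) * f t := fun p f hf x =>
    (((contDiff_peval p (n := 0)).continuous.comp (by fun_prop)).mul
      hf.1.continuous).integrable_of_hasCompactSupport hf.2.mul_left
  induction p using MvPolynomial.induction_on generalizing f with
  | C a => exact ⟨MvPolynomial.C (a * ∫ t, f t), fun x => by simp [peval, integral_const_mul]⟩
  | add p q hp hq =>
    obtain ⟨p', hp'⟩ := hp hf
    obtain ⟨q', hq'⟩ := hq hf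
    refine ⟨p' + q', fun x => ?_⟩
    have : ∀ t, peval (p + q) (x - t) * f t = peval p (x - t) * f t + peval q (x - t) * f t := by
      intro t; simp [peval, add_mul]
    simp only [this]
    rw [integral_add (hInt p hf x) (hInt q hf x), hp', hq']
    simp [peval]
  | mul_X p i hp =>
    have hg : IsTestFun fun t => t i * f t := IsTestFun.mul_left
      (f := fun t : Euc d => t i) (EuclideanSpace.proj (𝕜 := ℝ) i).contDiff hf
    obtain ⟨q₁, h₁⟩ := hp hf
    obtain ⟨q₂, h₂⟩ := hp hg
    refine ⟨MvPolynomial.X i * q₁ - q₂, fun x => ?_⟩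
    have : ∀ t, peval (p * MvPolynomial.X i) (x - t) * f t =
        x i * (peval p (x - t) * f t) - peval p (x - t) * (t i * f t) := by
      intro t; simp [peval]; ring
    simp only [this]
    rw [integral_sub ((hInt p hf x).const_mul _) (hInt p hg x), integral_const_mul, h₁, h₂]
    simp [peval]

/-- The Stone–Weierstrass theorem on balls of Euclidean space. -/
theorem exists_peval_sub_le {d : ℕ} {f : Euc d → ℝ} (hf : Continuous f) (R : ℝ) {ε : ℝ}
    (hε : 0 < ε) : ∃ p : MvPolynomial (Fin d) ℝ, ∀ x, ‖x‖ ≤ R → |peval p x - f x| ≤ ε := by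
  let K := closedBall (0 : Euc d) R
  have : CompactSpace K := isCompact_iff_compactSpace.1 (isCompact_closedBall 0 R)
  let co : Fin d → C(K, ℝ) := fun i => ⟨fun x => x.1 i, by fun_prop⟩
  let A : Subalgebra ℝ C(K, ℝ) := (MvPolynomial.aeval (R := ℝ) co).range
  have hev : ∀ (p : MvPolynomial (Fin d) ℝ) (x : K), MvPolynomial.aeval co p x = peval p x := by
    intro p x
    induction p using MvPolynomial.induction_on with
    | C a => simp [peval]
    | add p q hp hq => rw [map_add, ContinuousMap.add_apply, hp, hq]; simp [peval]
    | mul_X p i hp => rw [map_mul, ContinuousMap.mul_apply, hp]; simp [peval, co]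
  have hA : A.SeparatesPoints := by
    intro x y hxy
    by_contra! h
    refine hxy (Subtype.ext (PiLp.ext fun i => ?_))
    simpa [co] using h (co i) ⟨co i, ⟨MvPolynomial.X i, by simp⟩, rfl⟩
  obtain ⟨⟨_, p, rfl⟩, hg⟩ := ContinuousMap.exists_mem_subalgebra_near_continuous_of_separatesPoints
    A hA (fun x : K => f x) (hf.comp continuous_subtype_val) ε hε
  refine ⟨p, fun x hx => ?_⟩
  have := hg ⟨x, mem_closedBall_zero_iff.2 hx⟩
  rw [← hev p ⟨x, mem_closedBall_zero_iff.2 hx⟩]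
  exact this.le

/-- Smooth compactly supported functions can be approximated by polynomials on the unit ball,
together with finitely many derivatives. -/
theorem IsTestFun.exists_iteratedFDeriv_sub_peval_le {d : ℕ} {f : Euc d → ℝ} (hf : IsTestFun f)
    (n : ℕ) {ε : ℝ} (hε : 0 < ε) : ∃ p : MvPolynomial (Fin d) ℝ, ∀ m ≤ n, ∀ x : Euc d, ‖x‖ ≤ 1 →
      ‖iteratedFDeriv ℝ m (f - peval p) x‖ ≤ ε := by
  obtain ⟨ρ, hρ⟩ := hf.2.isBounded.subset_closedBall (0 : Euc d)
  choose δ hδ h using fun m => exists_convolution_sub_bound m hf.1 hρ hε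
  obtain ⟨δ', hδ', hle⟩ : ∃ δ' > 0, ∀ m ≤ n, δ' ≤ δ m := by
    obtain ⟨m₀, -, hm₀⟩ := Finset.exists_min_image (Finset.range (n + 1)) δ ⟨0, by simp⟩
    exact ⟨δ m₀, hδ m₀, fun m hm => hm₀ m (by simp; omega)⟩
  let φ : ContDiffBump (0 : Euc d) := ⟨δ' / 2, δ', by positivity, by linarith⟩
  obtain ⟨k, hk⟩ := exists_peval_sub_le φ.continuous_normed (1 + ρ) hδ' (f := φ.normed volume)
  obtain ⟨q, hq⟩ := exists_peval_eq_integral k hf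
  refine ⟨q, fun m hm x hx => ?_⟩
  have := h m (peval k) φ (contDiff_peval k (n := 0)).continuous (hle m hm)
    (fun t ht => (hk t ht).trans (hle m hm)) x hx
  have e : convolution (peval k) f (ContinuousLinearMap.lsmul ℝ ℝ) volume = peval q := by
    ext y
    rw [← hq, convolution]
    rw [← integral_sub_left_eq_self _ volume y]
    simp
  rw [e] at this
  rwa [← neg_sub, iteratedFDeriv_neg, Pi.neg_apply, norm_neg]

end approx

/-! ### Continuity of the covariance and density of polynomials -/

/-- Weighted superposition of a sequence of functions. -/
def superpose {d : ℕ} (w : ℕ → Euc d → ℝ) (a : BoundedContinuousFunction ℕ ℝ) : Euc d → ℝ :=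
  fun x => ∑' n, (a n • w n) x

theorem summable_one_div_add_one_sq : Summable fun n : ℕ => 1 / ((n : ℝ) + 1) ^ 2 := by
  have := (summable_nat_add_iff 1).2 (Real.summable_one_div_nat_pow.2 (by norm_num : 1 < 2))
  simpa using this

section superpose

variable {d : ℕ} {w : ℕ → Euc d → ℝ} {C : ℕ → ℝ}

theorem norm_iteratedFDeriv_weight_smul_le (hw : ∀ n, IsTestFun (w n))
    (hC : ∀ m n x, ‖iteratedFDeriv ℝ m (w n) x‖ ≤ C m * (1 / ((n : ℝ) + 1) ^ 2))
    (a : BoundedContinuousFunction ℕ ℝ) (m n : ℕ) (x : Euc d) :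
    ‖iteratedFDeriv ℝ m (a n • w n) x‖ ≤ ‖a‖ * C m * (1 / ((n : ℝ) + 1) ^ 2) := by
  have h2 : ContDiffAt ℝ m (w n) x := (hw n).1.contDiffAt.of_le (by
    exact WithTop.coe_le_coe.2 le_top)
  rw [iteratedFDeriv_const_smul_apply h2, norm_smul, mul_assoc]
  exact mul_le_mul (a.norm_coe_le_norm n) (hC m n x) (norm_nonneg _) (norm_nonneg _)

theorem contDiff_superpose (hw : ∀ n, IsTestFun (w n))
    (hC : ∀ m n x, ‖iteratedFDeriv ℝ m (w n) x‖ ≤ C m * (1 / ((n : ℝ) + 1) ^ 2))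
    (a : BoundedContinuousFunction ℕ ℝ) : ContDiff ℝ (⊤ : ℕ∞) (superpose w a) := by
  refine contDiff_tsum (v := fun (m n : ℕ) => ‖a‖ * C m * (1 / ((n : ℝ) + 1) ^ 2))
    (fun n => ((hw n).smul (a n)).1) (fun m _ => summable_one_div_add_one_sq.mul_left _)
    fun m n x _ => norm_iteratedFDeriv_weight_smul_le hw hC a m n x

theorem norm_iteratedFDeriv_superpose_le (hw : ∀ n, IsTestFun (w n))
    (hC : ∀ m n x, ‖iteratedFDeriv ℝ m (w n) x‖ ≤ C m * (1 / ((n : ℝ) + 1) ^ 2))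
    (a : BoundedContinuousFunction ℕ ℝ) (m : ℕ) (x : Euc d) :
    ‖iteratedFDeriv ℝ m (superpose w a) x‖ ≤
      ‖a‖ * (C m * ∑' n : ℕ, 1 / ((n : ℝ) + 1) ^ 2) := by
  have h := iteratedFDeriv_tsum_apply (𝕜 := ℝ) (N := (⊤ : ℕ∞)) (f := fun n => a n • w n)
    (v := fun (m n : ℕ) => ‖a‖ * C m * (1 / ((n : ℝ) + 1) ^ 2))
    (fun n => ((hw n).smul (a n)).1) (fun m _ => summable_one_div_add_one_sq.mul_left _)
    (fun m n x _ => norm_iteratedFDeriv_weight_smul_le hw hC a m n x) (k := m) le_top x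
  have h' : iteratedFDeriv ℝ m (superpose w a) x = _ := h
  rw [h', ← mul_assoc, ← tsum_mul_left]
  exact tsum_of_norm_bounded (summable_one_div_add_one_sq.mul_left _).hasSum
    fun n => norm_iteratedFDeriv_weight_smul_le hw hC a m n x

theorem summable_superpose
    (hC : ∀ m n x, ‖iteratedFDeriv ℝ m (w n) x‖ ≤ C m * (1 / ((n : ℝ) + 1) ^ 2))
    (a : BoundedContinuousFunction ℕ ℝ) (x : Euc d) : Summable fun n => (a n • w n) x := by
  refine Summable.of_norm_bounded (summable_one_div_add_one_sq.mul_left (‖a‖ * C 0)) fun n => ?_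
  rw [Pi.smul_apply, norm_smul, mul_assoc]
  have := hC 0 n x
  rw [norm_iteratedFDeriv_zero] at this
  exact mul_le_mul (a.norm_coe_le_norm n) this (norm_nonneg _) (norm_nonneg _)

theorem superpose_add
    (hC : ∀ m n x, ‖iteratedFDeriv ℝ m (w n) x‖ ≤ C m * (1 / ((n : ℝ) + 1) ^ 2))
    (a b : BoundedContinuousFunction ℕ ℝ) :
    superpose w (a + b) = superpose w a + superpose w b := by
  ext x
  simp only [superpose, Pi.add_apply]
  rw [← (summable_superpose hC a x).tsum_add (summable_superpose hC b x)]
  simp [add_mul]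

theorem superpose_smul (a : BoundedContinuousFunction ℕ ℝ) (t : ℝ) :
    superpose w (t • a) = t • superpose w a := by
  ext x
  simp only [superpose, Pi.smul_apply, smul_eq_mul]
  rw [← tsum_mul_left]
  simp [mul_assoc]

theorem superpose_eq_zero (a : BoundedContinuousFunction ℕ ℝ) {K : Set (Euc d)}
    (hK : ∀ n, tsupport (w n) ⊆ K) {x : Euc d}
    (hx : x ∉ K) : superpose w a x = 0 := by
  have : ∀ n, w n x = 0 := fun n => image_eq_zero_of_notMem_tsupport fun h => hx (hK n h)
  simp [superpose, this]

end superpose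

namespace GFF

variable {d : ℕ} {Ω : Type} [MeasurableSpace Ω] {X : GFF d Ω}

variable (X) in
/-- The covariance form. -/
def K2 (f g : Euc d → ℝ) : ℝ := ∫ ω, X.h 0 1 f ω * X.h 0 1 g ω ∂X.P

theorem K2_self {f : Euc d → ℝ} (hf : IsTestFun f) : X.K2 f f = X.N f ^ 2 := by
  rw [N_sq hf, K2]
  simp only [sq]

theorem integrable_h_mul {f g : Euc d → ℝ} (hf : IsTestFun f) (hg : IsTestFun g) :
    Integrable (fun ω => X.h 0 1 f ω * X.h 0 1 g ω) X.P :=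
  (memLp_h hf).integrable_mul (memLp_h hg)

theorem K2_add {f₁ f₂ g : Euc d → ℝ} (h₁ : IsTestFun f₁) (h₂ : IsTestFun f₂)
    (hg : IsTestFun g) : X.K2 (f₁ + f₂) g = X.K2 f₁ g + X.K2 f₂ g := by
  rw [K2, K2, K2, ← integral_add (integrable_h_mul h₁ hg) (integrable_h_mul h₂ hg)]
  refine integral_congr_ae ?_
  filter_upwards [X.lin_add f₁ f₂ h₁ h₂] with ω e
  rw [e, add_mul]

theorem K2_smul (t : ℝ) {f : Euc d → ℝ} (hf : IsTestFun f) (g : Euc d → ℝ) :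
    X.K2 (t • f) g = t * X.K2 f g := by
  rw [K2, K2, ← integral_const_mul]
  refine integral_congr_ae ?_
  filter_upwards [X.lin_smul t f hf] with ω e
  rw [e, mul_assoc]

theorem K2_comm (f g : Euc d → ℝ) : X.K2 f g = X.K2 g f := by
  simp only [K2, mul_comm]

theorem abs_K2_le {f g : Euc d → ℝ} (hf : IsTestFun f) (hg : IsTestFun g) :
    |X.K2 f g| ≤ (X.N f ^ 2 + X.N g ^ 2) / 2 := by
  have h1 := (memLp_h (X := X) hf).integrable_sq
  have h2 := (memLp_h (X := X) hg).integrable_sq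
  rw [N_sq hf, N_sq hg, ← integral_add h1 h2, ← integral_div]
  refine (abs_integral_le_integral_abs).trans
    (integral_mono (integrable_h_mul hf hg).abs ((h1.add h2).div_const 2) fun ω => ?_)
  simp only [abs_mul]
  nlinarith [sq_nonneg (|X.h 0 1 f ω| - |X.h 0 1 g ω|), sq_abs (X.h 0 1 f ω),
    sq_abs (X.h 0 1 g ω)]

/-- A sequence of test functions supported in a fixed compact set all of whose derivatives are
uniformly bounded by a summable sequence is bounded for the covariance seminorm. -/
theorem exists_N_le {K : Set (Euc d)} (hK : IsCompact K) (hK1 : K ⊆ ball 0 1)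
    {w : ℕ → Euc d → ℝ} (hw : ∀ n, IsTestFun (w n)) (hwK : ∀ n, tsupport (w n) ⊆ K) {C : ℕ → ℝ}
    (hC : ∀ m n x, ‖iteratedFDeriv ℝ m (w n) x‖ ≤ C m * (1 / ((n : ℝ) + 1) ^ 2)) :
    ∃ B, ∀ n, X.N (w n) ≤ B := by
  have hts : ∀ a, tsupport (superpose w a) ⊆ K := fun a =>
    closure_minimal (fun x hx => by
      by_contra h
      exact hx (superpose_eq_zero a hwK h)) hK.isClosed
  have hA : ∀ a, IsTestFun (superpose w a) := fun a =>
    ⟨contDiff_superpose hw hC a, HasCompactSupport.of_support_subset_isCompact hK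
      ((subset_tsupport _).trans (hts a))⟩
  let ι := {g : Euc d → ℝ // IsTestFun g ∧ tsupport g ⊆ ball 0 1 ∧ X.N g ≤ 1}
  let L : ι → BoundedContinuousFunction ℕ ℝ →ₗ[ℝ] ℝ := fun g =>
    { toFun := fun a => X.K2 (superpose w a) g.1
      map_add' := fun a b => by
        rw [superpose_add hC, K2_add (hA a) (hA b) g.2.1]
      map_smul' := fun t a => by
        rw [superpose_smul, K2_smul t (hA a)]; rfl }
  have hL : ∀ g, Continuous (L g) := by
    intro g
    refine continuous_of_continuousAt_zero (L g) ?_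
    refine tendsto_of_seq_tendsto fun a ha => ?_
    have h0 : superpose w (0 : BoundedContinuousFunction ℕ ℝ) = 0 := by
      ext x; simp [superpose]
    refine X.K2_cont (fun n => superpose w (a n)) (superpose w 0) g.1 K hK hK1 (fun n => hA _)
      (hA _) g.2.1 g.2.2.1 (fun n => hts _) (hts _) fun m => ?_
    rw [h0, Metric.tendstoUniformly_iff]
    intro ε hε
    set M := |C m * ∑' n : ℕ, 1 / ((n : ℝ) + 1) ^ 2| with hM
    have hlim : Tendsto (fun n => ‖a n‖ * M) atTop (𝓝 0) := by
      simpa using (tendsto_zero_iff_norm_tendsto_zero.1 ha).mul_const M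
    filter_upwards [hlim.eventually (gt_mem_nhds hε)] with n hn x
    have hz : iteratedFDeriv ℝ m (0 : Euc d → ℝ) x = 0 := by simp
    rw [hz, dist_zero_left]
    exact ((norm_iteratedFDeriv_superpose_le hw hC (a n) m x).trans
      (mul_le_mul_of_nonneg_left (le_abs_self _) (norm_nonneg _))).trans_lt hn
  obtain ⟨B, hB⟩ := banach_steinhaus (𝕜 := ℝ) (𝕜₂ := ℝ) (σ₁₂ := RingHom.id ℝ)
    (g := fun g : ι => (⟨L g, hL g⟩ : BoundedContinuousFunction ℕ ℝ →L[ℝ] ℝ)) fun a => by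
      refine ⟨(X.N (superpose w a) ^ 2 + 1) / 2, fun g => ?_⟩
      refine (abs_K2_le (hA a) g.2.1).trans ?_
      have : X.N g.1 ^ 2 ≤ 1 := pow_le_one₀ N_nonneg g.2.2.2
      linarith
  refine ⟨max B 0, fun n => ?_⟩
  rcases (N_nonneg (X := X) (f := w n)).eq_or_lt with h0 | hpos
  · rw [← h0]; exact le_max_right _ _
  let g : ι := ⟨(X.N (w n))⁻¹ • w n, (hw n).smul _,
    ((closure_mono (Function.support_const_smul_subset _ _)).trans (hwK n)).trans hK1, by
      rw [N_smul _ (hw n), abs_of_pos (inv_pos.2 hpos), inv_mul_cancel₀ hpos.ne']⟩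
  let e : BoundedContinuousFunction ℕ ℝ :=
    BoundedContinuousFunction.ofNormedAddCommGroupDiscrete (fun k => if k = n then 1 else 0) 1
      fun k => by split_ifs <;> simp
  have he : superpose w e = w n := by
    ext x
    simp only [superpose, Pi.smul_apply]
    rw [tsum_eq_single n]
    · simp [e]
    · intro k hk
      simp [e, hk]
  have hen : ‖e‖ ≤ 1 := BoundedContinuousFunction.norm_ofNormedAddCommGroup_le _ zero_le_one _
  have h1 : L g e ≤ B := by
    have h2 := ContinuousLinearMap.le_opNorm
      (⟨L g, hL g⟩ : BoundedContinuousFunction ℕ ℝ →L[ℝ] ℝ) e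
    have h3 := hB g
    have h4 := ContinuousLinearMap.opNorm_nonneg
      (⟨L g, hL g⟩ : BoundedContinuousFunction ℕ ℝ →L[ℝ] ℝ)
    refine (le_abs_self _).trans (h2.trans ?_)
    nlinarith [norm_nonneg e]
  have h5 : L g e = X.N (w n) := by
    change X.K2 (superpose w e) ((X.N (w n))⁻¹ • w n) = _
    rw [he, K2_comm, K2_smul _ (hw n), K2_self (hw n), sq, inv_mul_cancel_left₀ hpos.ne']
  rw [← h5]
  exact h1.trans (le_max_left _ _)

theorem exists_iteratedFDeriv_bound {w : Euc d → ℝ} (hw : IsTestFun w) (m : ℕ) :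
    ∃ B, 0 ≤ B ∧ ∀ x, ‖iteratedFDeriv ℝ m w x‖ ≤ B := by
  obtain ⟨B, hB⟩ := (hw.2.iteratedFDeriv m).exists_bound_of_continuous
    (hw.1.continuous_iteratedFDeriv (m := m) (WithTop.coe_le_coe.2 le_top))
  exact ⟨B, (norm_nonneg _).trans (hB 0), hB⟩

/-- Polynomials are dense for the covariance seminorm. -/
theorem exists_N_sub_polyTest_le (hd : 2 ≤ d) {f : Euc d → ℝ} (hf : IsTestFun f) {ε : ℝ}
    (hε : 0 < ε) : ∃ p, X.N (f - polyTest p) ≤ ε := by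
  obtain ⟨δ₀, hδ₀, hlay⟩ := exists_layer_bound hd X 1 (half_pos hε)
  set δ := min (δ₀ / 2) (1 / 2) with hδ
  have hδpos : 0 < δ := by positivity
  have hδ2 : δ ≤ 1 / 2 := min_le_right _ _
  have hδlt : δ < δ₀ := (min_le_left _ _).trans_lt (by linarith)
  choose q hq using fun n : ℕ => hf.exists_iteratedFDeriv_sub_peval_le n
    (ε := 1 / ((n : ℝ) + 1) ^ 3) (by positivity)
  set u : ℕ → Euc d → ℝ := fun n => f - polyTest (q n) with hu
  have hut : ∀ n, IsTestFun (u n) := fun n => hf.sub (isTestFun_polyTest _)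
  have hub : ∀ n, ∀ m ≤ n, ∀ x : Euc d, ‖x‖ ≤ 1 →
      ‖iteratedFDeriv ℝ m (u n) x‖ ≤ 1 / ((n : ℝ) + 1) ^ 3 := by
    intro n m hm x hx
    have : u n =ᶠ[𝓝 x] f - peval (q n) := by
      filter_upwards [isOpen_ball.mem_nhds (show x ∈ ball (0 : Euc d) 2 by
        rw [mem_ball_zero_iff]; linarith)] with y hy
      simp only [hu, Pi.sub_apply]
      rw [polyTest_apply (mem_ball_zero_iff.1 hy).le]
    rw [(this.iteratedFDeriv ℝ m).eq_of_nhds]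
    exact hq n m hm x hx
  set κ : Euc d → ℝ := radialCutoff (1 - δ) (1 - δ / 2) with hκ
  have hκt : IsTestFun κ := isTestFun_radialCutoff (by linarith) (by linarith)
  have hκ0 : ∀ x : Euc d, x ∉ closedBall (0 : Euc d) (1 - δ / 2) → κ x = 0 := fun x hx => by
    rw [mem_closedBall_zero_iff, not_le] at hx
    exact radialCutoff_eq_zero (by linarith) (by linarith) hx.le
  -- the layer part
  have hlayer : ∀ n, X.N (u n - κ * u n) ≤ ε / 2 := by
    intro n
    refine hlay δ hδpos hδlt _ ((hut n).sub (IsTestFun.mul_left hκt.1 (hut n))) (fun x hx => ?_)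
      fun x hx => ?_
    · have h1 := hub n 0 (Nat.zero_le _) x hx.le
      rw [norm_iteratedFDeriv_zero, Real.norm_eq_abs] at h1
      have h2 : (1 : ℝ) / ((n : ℝ) + 1) ^ 3 ≤ 1 := by
        rw [div_le_one (by positivity)]
        exact one_le_pow₀ (by linarith [Nat.cast_nonneg (α := ℝ) n])
      have h3 : (1 : ℝ) ≤ 1 / δ := by rw [le_div_iff₀ hδpos]; linarith
      have e : (u n - κ * u n) x = (1 - κ x) * u n x := by
        simp only [Pi.sub_apply, Pi.mul_apply]; ring
      rw [e, abs_mul, abs_of_nonneg (sub_nonneg.2 radialCutoff_le_one)]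
      have h4 : 1 - κ x ≤ 1 := sub_le_self _ radialCutoff_nonneg
      calc (1 - κ x) * |u n x| ≤ 1 * 1 := by
            gcongr
            exact h1.trans h2
        _ ≤ 1 / δ := by linarith
    · simp only [Pi.sub_apply, Pi.mul_apply, hκ]
      rw [radialCutoff_eq_one (by linarith) (by linarith) hx.le]
      ring
  -- the inner part
  set w : ℕ → Euc d → ℝ := fun n => ((n : ℝ) + 1) • (κ * u n) with hw
  have hwt : ∀ n, IsTestFun (w n) := fun n => (IsTestFun.mul_left hκt.1 (hut n)).smul _
  have hwK : ∀ n, tsupport (w n) ⊆ closedBall (0 : Euc d) (1 - δ / 2) := fun n => by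
    refine closure_minimal (fun x hx => ?_) isClosed_closedBall
    by_contra h
    exact hx (by simp [hw, hκ0 x h])
  choose Bκ hBκ0 hBκ using fun m => exists_iteratedFDeriv_bound hκt m
  choose Bw hBw0 hBw using fun m n => exists_iteratedFDeriv_bound (hwt n) m
  have hC : ∀ m n x, ‖iteratedFDeriv ℝ m (w n) x‖ ≤
      ((∑ i ∈ Finset.range (m + 1), (m.choose i : ℝ) * Bκ i) +
        ∑ k ∈ Finset.range m, Bw m k * ((k : ℝ) + 1) ^ 2) * (1 / ((n : ℝ) + 1) ^ 2) := by
    intro m n x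
    have hS1 : 0 ≤ ∑ i ∈ Finset.range (m + 1), (m.choose i : ℝ) * Bκ i :=
      Finset.sum_nonneg fun i _ => mul_nonneg (Nat.cast_nonneg _) (hBκ0 i)
    have hS2 : 0 ≤ ∑ k ∈ Finset.range m, Bw m k * ((k : ℝ) + 1) ^ 2 :=
      Finset.sum_nonneg fun k _ => mul_nonneg (hBw0 m k) (by positivity)
    have hn : (0 : ℝ) < (n : ℝ) + 1 := by positivity
    rcases lt_or_ge n m with hnm | hnm
    · have h1 : Bw m n * ((n : ℝ) + 1) ^ 2 ≤
          ∑ k ∈ Finset.range m, Bw m k * ((k : ℝ) + 1) ^ 2 :=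
        Finset.single_le_sum (f := fun k : ℕ => Bw m k * ((k : ℝ) + 1) ^ 2)
          (fun k _ => mul_nonneg (hBw0 m k) (by positivity)) (Finset.mem_range.2 hnm)
      refine (hBw m n x).trans ?_
      rw [mul_one_div, le_div_iff₀ (by positivity)]
      linarith
    · by_cases hx : ‖x‖ ≤ 1
      · have hsm : ContDiffAt ℝ m (κ * u n) x :=
          (IsTestFun.mul_left hκt.1 (hut n)).1.contDiffAt.of_le (WithTop.coe_le_coe.2 le_top)
        have h1 := norm_iteratedFDeriv_mul_le hκt.1 (hut n).1 x (n := m)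
          (WithTop.coe_le_coe.2 le_top)
        have h2 : ‖iteratedFDeriv ℝ m (κ * u n) x‖ ≤
            (∑ i ∈ Finset.range (m + 1), (m.choose i : ℝ) * Bκ i) * (1 / ((n : ℝ) + 1) ^ 3) := by
          refine h1.trans ?_
          rw [Finset.sum_mul]
          refine Finset.sum_le_sum fun i hi => ?_
          have := hBκ0 i
          exact mul_le_mul (mul_le_mul_of_nonneg_left (hBκ i x) (Nat.cast_nonneg _))
            (hub n _ (by omega) x hx) (norm_nonneg _) (by positivity)
        rw [hw, iteratedFDeriv_const_smul_apply hsm, norm_smul, Real.norm_eq_abs, abs_of_pos hn]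
        calc _ ≤ ((n : ℝ) + 1) * ((∑ i ∈ Finset.range (m + 1), (m.choose i : ℝ) * Bκ i) *
              (1 / ((n : ℝ) + 1) ^ 3)) := by gcongr
          _ = (∑ i ∈ Finset.range (m + 1), (m.choose i : ℝ) * Bκ i) *
              (1 / ((n : ℝ) + 1) ^ 2) := by field_simp
          _ ≤ _ := by gcongr; linarith
      · have h0 : iteratedFDeriv ℝ m (w n) x = 0 := by
          refine image_eq_zero_of_notMem_tsupport fun h => hx ?_
          have := hwK n (tsupport_iteratedFDeriv_subset m h)
          rw [mem_closedBall_zero_iff] at this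
          linarith
        rw [h0, norm_zero]
        positivity
  obtain ⟨B, hB⟩ := exists_N_le (X := X) (isCompact_closedBall (0 : Euc d) (1 - δ / 2))
    (closedBall_subset_ball (by linarith)) hwt hwK hC
  obtain ⟨n, hn⟩ := exists_nat_gt (B / (ε / 2))
  have hin : X.N (κ * u n) ≤ ε / 2 := by
    have h1 := hB n
    have hn' : (0 : ℝ) < (n : ℝ) + 1 := by positivity
    rw [hw, N_smul _ (IsTestFun.mul_left hκt.1 (hut n)), abs_of_pos hn'] at h1
    rw [div_lt_iff₀ (by positivity)] at hn
    by_contra! hcon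
    nlinarith
  refine ⟨q n, ?_⟩
  have h1 := N_add_le (X := X) ((hut n).sub (IsTestFun.mul_left hκt.1 (hut n)))
    (IsTestFun.mul_left hκt.1 (hut n))
  rw [sub_add_cancel] at h1
  linarith [hlayer n]

/-- The characteristic functional vanishes nowhere. -/
theorem c_ne_zero (hd : 2 ≤ d) {f : Euc d → ℝ} (hf : IsTestFun f) : X.c f ≠ 0 := by
  set η := Real.exp (-(X.N f + 1) ^ 2) / 2 with hη
  have hη0 : 0 < η := by positivity
  obtain ⟨p, hp⟩ := exists_N_sub_polyTest_le (X := X) hd hf (lt_min hη0 one_pos)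
  intro h0
  have h1 := norm_c_sub_le (X := X) hf (isTestFun_polyTest p)
  rw [h0, zero_sub, norm_neg] at h1
  have h2 := exp_neg_le_norm_c_polyTest (X := X) p
  have h3 := (abs_le.1 (abs_N_sub_N_le (X := X) hf (isTestFun_polyTest p))).1
  have h4 : X.N (polyTest p) ≤ X.N f + 1 := by linarith [hp.trans (min_le_right _ _)]
  have h5 : Real.exp (-(X.N f + 1) ^ 2) ≤ Real.exp (-X.N (polyTest p) ^ 2) :=
    Real.exp_le_exp.2 (neg_le_neg (pow_le_pow_left₀ N_nonneg h4 2))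
  linarith [hp.trans (min_le_left _ _)]

end GFF

/-! ### Locality of the characteristic functional -/

/-- A test function supported in a union of open sets is a finite sum of test functions, each
supported in one of them. -/
theorem IsTestFun.exists_finset_sum {d : ℕ} {g : Euc d → ℝ} (hg : IsTestFun g) {ι : Type*}
    (U : ι → Set (Euc d)) (hU : ∀ i, IsOpen (U i)) (hgU : tsupport g ⊆ ⋃ i, U i) :
    ∃ (s : Finset ι) (u : ι → Euc d → ℝ), (∀ i, IsTestFun (u i)) ∧
      (∀ i, tsupport (u i) ⊆ U i) ∧ g = ∑ i ∈ s, u i := by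
  classical
  obtain ⟨t, ht⟩ := (show IsCompact (tsupport g) from hg.2).elim_finite_subcover U hU hgU
  obtain ⟨φ, hφ⟩ := SmoothPartitionOfUnity.exists_isSubordinate (modelWithCornersSelf ℝ (Euc d))
    (isClosed_tsupport g) (fun i : t => U i) (fun i => hU i) (by
      intro x hx
      obtain ⟨i, hi, hxi⟩ := mem_iUnion₂.1 (ht hx)
      exact mem_iUnion.2 ⟨⟨i, hi⟩, hxi⟩)
  have hsm : ∀ i, ContDiff ℝ (⊤ : ℕ∞) (φ i) := fun i => (φ i).contMDiff.contDiff
  refine ⟨t, fun i => if hi : i ∈ t then (φ ⟨i, hi⟩ : Euc d → ℝ) * g else 0, fun i => ?_,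
    fun i => ?_, ?_⟩
  · dsimp only
    split_ifs with hi
    · exact IsTestFun.mul_left (hsm _) hg
    · exact isTestFun_zero
  · dsimp only
    split_ifs with hi
    · exact (tsupport_mul_subset_left).trans (hφ ⟨i, hi⟩)
    · simp [tsupport]
  · ext x
    rw [Finset.sum_apply, ← Finset.sum_coe_sort]
    simp only [Finset.coe_mem, dite_true, Pi.mul_apply, Subtype.coe_eta]
    rw [← Finset.sum_mul]
    by_cases hx : x ∈ tsupport g
    · have := φ.sum_eq_one hx
      rw [finsum_eq_sum_of_fintype] at this
      rw [this, one_mul]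
    · rw [image_eq_zero_of_notMem_tsupport hx, mul_zero]

namespace GFF

variable {d : ℕ} {Ω : Type} [MeasurableSpace Ω] {X : GFF d Ω}

variable (X) in
/-- The interaction of `f₂` and `f₃` in presence of `f`. -/
def Q (f₂ f₃ f : Euc d → ℝ) : ℂ := X.c (f + f₂ + f₃) * X.c f / (X.c (f + f₂) * X.c (f + f₃))

theorem Q_comm (f₂ f₃ f : Euc d → ℝ) : X.Q f₂ f₃ f = X.Q f₃ f₂ f := by
  rw [Q, Q, add_right_comm, mul_comm (X.c (f + f₂))]

theorem c_add_div_c_eq (hd : 2 ≤ d) {a : Euc d} {r : ℝ} (hr : 0 < r)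
    (hb : ball a r ⊆ ball (0 : Euc d) 1) {f e : Euc d → ℝ} (hf : IsTestFun f) (he : IsTestFun e)
    (h0 : ∀ x ∈ ball a r, e x = 0) : X.c (f + e) / X.c f = X.β a r (f + e) / X.β a r f := by
  rw [c_eq_mul_β (X := X) hr hb (hf.add he), c_eq_mul_β (X := X) hr hb hf]
  have : X.c (scl a r (f + e)) = X.c (scl a r f) := by
    refine c_congr ((hf.add he).scl a hr) (hf.scl a hr) fun x hx => ?_
    have hx' : a + r • x ∈ ball a r := by
      rw [mem_ball_zero_iff] at hx
      rw [mem_ball, dist_eq_norm, add_sub_cancel_left, norm_smul, Real.norm_eq_abs,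
        abs_of_pos hr]
      nlinarith
    simp [scl, h0 _ hx']
  rw [this, mul_div_mul_left _ _ (c_ne_zero hd (hf.scl a hr))]

theorem Q_add_lap_of_ball (hd : 2 ≤ d) {a : Euc d} {r : ℝ} (hr : 0 < r)
    (hb : ball a r ⊆ ball (0 : Euc d) 1) {f f₂ f₃ g : Euc d → ℝ} (hf : IsTestFun f)
    (hf₂ : IsTestFun f₂) (hf₃ : IsTestFun f₃) (hg : IsTestFun g) (hgs : tsupport g ⊆ ball a r)
    (h0 : ∀ x ∈ ball a r, f₃ x = 0) : X.Q f₂ f₃ (f + lap g) = X.Q f₂ f₃ f := by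
  have key : ∀ u, IsTestFun u → X.c (u + lap g + f₃) / X.c (u + lap g) =
      X.c (u + f₃) / X.c u := by
    intro u hu
    rw [c_add_div_c_eq hd hr hb (hu.add hg.lap) hf₃ h0, c_add_div_c_eq hd hr hb hu hf₃ h0,
      add_right_comm, β_add_lap hr hb (hu.add hf₃) hg hgs, β_add_lap hr hb hu hg hgs]
  have e : ∀ u : Euc d → ℝ, X.Q f₂ f₃ u =
      (X.c (u + f₂ + f₃) / X.c (u + f₂)) / (X.c (u + f₃) / X.c u) := by
    intro u
    rw [Q, div_div_div_eq]
  rw [e, e, key f hf, add_right_comm f, key _ (hf.add hf₂)]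

/-- The interaction of two test functions with disjoint supports is not affected by a
perturbation by a Laplacian. -/
theorem Q_add_lap (hd : 2 ≤ d) {f f₂ f₃ g : Euc d → ℝ} (hf : IsTestFun f)
    (hf₂ : IsTestFun f₂) (hf₃ : IsTestFun f₃) (hdis : Disjoint (tsupport f₂) (tsupport f₃))
    (hg : IsTestFun g) (hgs : tsupport g ⊆ ball 0 1) :
    X.Q f₂ f₃ (f + lap g) = X.Q f₂ f₃ f := by
  let ι := {p : Euc d × ℝ // 0 < p.2 ∧ ball p.1 p.2 ⊆ ball (0 : Euc d) 1 ∧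
    ((∀ x ∈ ball p.1 p.2, f₂ x = 0) ∨ ∀ x ∈ ball p.1 p.2, f₃ x = 0)}
  obtain ⟨s, u, hu, hus, hgu⟩ := hg.exists_finset_sum (fun p : ι => ball p.1.1 p.1.2)
    (fun _ => isOpen_ball) (by
      intro x hx
      have h1 : ∃ i : Bool, x ∉ tsupport (cond i f₂ f₃) := by
        by_cases h : x ∈ tsupport f₂
        · exact ⟨false, disjoint_left.1 hdis h⟩
        · exact ⟨true, h⟩
      obtain ⟨i, hi⟩ := h1
      obtain ⟨r, hr, hrs⟩ := Metric.isOpen_iff.1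
        (isOpen_ball.inter (isClosed_tsupport (cond i f₂ f₃)).isOpen_compl) x ⟨hgs hx, hi⟩
      have h0 : ∀ y ∈ ball x r, cond i f₂ f₃ y = 0 := fun y hy =>
        image_eq_zero_of_notMem_tsupport (hrs hy).2
      refine mem_iUnion.2 ⟨⟨(x, r), hr, fun y hy => (hrs hy).1, ?_⟩, mem_ball_self hr⟩
      cases i
      · exact Or.inr h0
      · exact Or.inl h0)
  rw [hgu, lap_sum s fun i _ => hu i]
  clear hgu
  classical
  induction s using Finset.induction_on with
  | empty => simp
  | insert i s hi ih =>
    rw [Finset.sum_insert hi, add_comm (lap (u i)), ← add_assoc]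
    have hs : IsTestFun (f + ∑ j ∈ s, lap (u j)) :=
      hf.add (IsTestFun.sum s fun j _ => (hu j).lap)
    rw [← ih]
    rcases i.2.2.2 with h | h
    · rw [Q_comm, Q_add_lap_of_ball hd i.2.1 i.2.2.1 hs hf₃ hf₂ (hu i) (hus i) h, Q_comm]
    · exact Q_add_lap_of_ball hd i.2.1 i.2.2.1 hs hf₂ hf₃ (hu i) (hus i) h

end GFF

/-! ### The Dirichlet problem for polynomials in the unit ball -/

section dirichlet

variable {d : ℕ}

theorem hasDerivAt_peval_line (p : MvPolynomial (Fin d) ℝ) (x : Euc d) (i : Fin d) (t : ℝ) :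
    HasDerivAt (fun t : ℝ => peval p (x + t • EuclideanSpace.single i (1 : ℝ)))
      (peval (MvPolynomial.pderiv i p) (x + t • EuclideanSpace.single i (1 : ℝ))) t := by
  induction p using MvPolynomial.induction_on with
  | C a =>
    simp only [peval, MvPolynomial.eval_C, MvPolynomial.pderiv_C, map_zero]
    exact hasDerivAt_const _ _
  | add p q hp hq => simpa only [peval, map_add] using hp.fun_add hq
  | mul_X p j hp =>
    have h1 : HasDerivAt (fun t : ℝ => (x + t • EuclideanSpace.single i (1 : ℝ) : Euc d) j)
        (if j = i then 1 else 0) t := by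
      by_cases h : j = i
      · simpa [h] using (hasDerivAt_id t).const_add (x i)
      · simpa [h] using hasDerivAt_const t (x j)
    have h2 := hp.fun_mul h1
    simp only [peval, map_mul, MvPolynomial.eval_X] at h2 ⊢
    refine h2.congr_deriv ?_
    by_cases h : j = i
    · subst h; simp; ring
    · simp [MvPolynomial.pderiv_X_of_ne h, h, mul_comm]

theorem pd_peval (p : MvPolynomial (Fin d) ℝ) (i : Fin d) :
    pd i (peval p) = peval (MvPolynomial.pderiv i p) := by
  ext x
  have h1 := ((contDiff_peval (n := 1) p).differentiable (by norm_num)).differentiableAt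
    (x := x) |>.hasFDerivAt
  have h2 : HasDerivAt (fun t : ℝ => x + t • EuclideanSpace.single i (1 : ℝ))
      (EuclideanSpace.single i (1 : ℝ)) 0 := by
    simpa using ((hasDerivAt_id (0 : ℝ)).smul_const (EuclideanSpace.single i (1 : ℝ))).const_add x
  have h3 := HasFDerivAt.comp_hasDerivAt (x := (0 : ℝ)) (hl := by simpa using h1) (hf := h2)
  have h4 := hasDerivAt_peval_line p x i 0
  rw [zero_smul, add_zero] at h4
  exact h3.unique h4

/-- The Laplacian of polynomials. -/
def polyLap : MvPolynomial (Fin d) ℝ →ₗ[ℝ] MvPolynomial (Fin d) ℝ :=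
  ∑ i, (MvPolynomial.pderiv i).toLinearMap ∘ₗ (MvPolynomial.pderiv i).toLinearMap

theorem polyLap_apply (p : MvPolynomial (Fin d) ℝ) :
    polyLap p = ∑ i, MvPolynomial.pderiv i (MvPolynomial.pderiv i p) := by
  simp [polyLap]

theorem lap_peval (p : MvPolynomial (Fin d) ℝ) : lap (peval p) = peval (polyLap p) := by
  ext x
  rw [lap_eq_sum_pd (contDiff_peval p).contDiffAt, polyLap_apply]
  simp only [pd_peval]
  simp [peval, map_sum]

theorem totalDegree_pderiv_le (p : MvPolynomial (Fin d) ℝ) (i : Fin d) :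
    (MvPolynomial.pderiv i p).totalDegree ≤ p.totalDegree - 1 := by
  have h : MvPolynomial.pderiv i p =
      ∑ s ∈ p.support, MvPolynomial.monomial (s - Finsupp.single i 1) (p.coeff s * s i) := by
    conv_lhs => rw [p.as_sum, map_sum]
    exact Finset.sum_congr rfl fun s _ => MvPolynomial.pderiv_monomial
  rw [h]
  refine MvPolynomial.totalDegree_finsetSum_le fun s hs => ?_
  by_cases h0 : s i = 0
  · simp [h0]
  · refine (MvPolynomial.totalDegree_monomial_le _ _).trans ?_
    have h1 := MvPolynomial.le_totalDegree hs
    have h2 : (s - Finsupp.single i 1) + Finsupp.single i 1 = s :=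
      tsub_add_cancel_of_le (Finsupp.single_le_iff.2 (Nat.one_le_iff_ne_zero.2 h0))
    have h3 : s.sum (fun _ e => e) = (s - Finsupp.single i 1).sum (fun _ e => e) + 1 := by
      conv_lhs => rw [← h2]
      rw [Finsupp.sum_add_index' (fun _ => rfl) fun _ _ _ => rfl]
      simp
    change (s - Finsupp.single i 1).sum (fun _ e => e) ≤ _
    omega

theorem totalDegree_polyLap_le (p : MvPolynomial (Fin d) ℝ) :
    (polyLap p).totalDegree ≤ p.totalDegree - 2 := by
  rw [polyLap_apply]
  refine MvPolynomial.totalDegree_finsetSum_le fun i _ => ?_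
  have h1 := totalDegree_pderiv_le p i
  have h2 := totalDegree_pderiv_le (MvPolynomial.pderiv i p) i
  omega

/-- The square of the Euclidean norm as a polynomial. -/
def normSqPoly (d : ℕ) : MvPolynomial (Fin d) ℝ := ∑ i, MvPolynomial.X i ^ 2

theorem peval_normSqPoly (x : Euc d) : peval (normSqPoly d) x = ‖x‖ ^ 2 := by
  simp [peval, normSqPoly, EuclideanSpace.norm_sq_eq]

theorem polyLap_normSqPoly : polyLap (normSqPoly d) = MvPolynomial.C (2 * d : ℝ) := by
  have h : ∀ i j : Fin d, MvPolynomial.pderiv i (MvPolynomial.pderiv i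
      (MvPolynomial.X j ^ 2 : MvPolynomial (Fin d) ℝ)) = if j = i then 2 else 0 := by
    intro i j
    by_cases h : j = i
    · subst h
      have h2 : MvPolynomial.pderiv j (2 : MvPolynomial (Fin d) ℝ) = 0 :=
        (MvPolynomial.pderiv j).map_natCast 2
      simp [h2]
    · simp [h, MvPolynomial.pderiv_X_of_ne h]
  simp only [polyLap_apply, normSqPoly, map_sum, h]
  have h2 : (2 : MvPolynomial (Fin d) ℝ) = MvPolynomial.C 2 := (map_ofNat MvPolynomial.C 2).symm
  simp [mul_comm, h2]

theorem totalDegree_normSqPoly_le : (normSqPoly d).totalDegree ≤ 2 := by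
  refine MvPolynomial.totalDegree_finsetSum_le fun i _ => ?_
  exact (MvPolynomial.totalDegree_pow _ _).trans (by simp)

theorem peval_polyLap_nonpos {p : MvPolynomial (Fin d) ℝ} {x : Euc d}
    (hx : IsLocalMax (peval p) x) : peval (polyLap p) x ≤ 0 := by
  have : peval (polyLap p) x =
      ∑ i, peval (MvPolynomial.pderiv i (MvPolynomial.pderiv i p)) x := by
    rw [polyLap_apply]; simp [peval, map_sum]
  rw [this]
  refine Finset.sum_nonpos fun i _ => ?_
  by_contra! hpos
  set f : ℝ → ℝ := fun t => peval p (x + t • EuclideanSpace.single i (1 : ℝ)) with hf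
  have hd1 : deriv f = fun t => peval (MvPolynomial.pderiv i p)
      (x + t • EuclideanSpace.single i (1 : ℝ)) :=
    funext fun t => (hasDerivAt_peval_line p x i t).deriv
  have hd2 : deriv (deriv f) 0 = peval (MvPolynomial.pderiv i (MvPolynomial.pderiv i p)) x := by
    rw [hd1, (hasDerivAt_peval_line (MvPolynomial.pderiv i p) x i 0).deriv]
    simp
  have hmax : IsLocalMax f 0 := by
    have hc : Tendsto (fun t : ℝ => x + t • EuclideanSpace.single i (1 : ℝ)) (𝓝 0) (𝓝 x) := by
      have : Continuous fun t : ℝ => x + t • EuclideanSpace.single i (1 : ℝ) := by fun_prop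
      simpa using this.tendsto 0
    filter_upwards [hc.eventually hx] with t ht
    simpa [hf] using ht
  have hmin : IsLocalMin f 0 := isLocalMin_of_deriv_deriv_pos (by rw [hd2]; exact hpos)
    hmax.deriv_eq_zero (hasDerivAt_peval_line p x i 0).continuousAt
  have hconst : f =ᶠ[𝓝 0] fun _ => f 0 := by
    filter_upwards [hmax, hmin] with t h1 h2 using le_antisymm h1 h2
  have h0 : deriv (deriv f) 0 = 0 := by
    have := hconst.deriv
    rw [this.deriv_eq]
    simp
  rw [hd2] at h0
  exact hpos.ne' h0

/-- A harmonic polynomial which vanishes on the unit sphere is nonpositive in the ball. -/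
theorem peval_nonpos_of_polyLap_eq_zero [NeZero d] {p : MvPolynomial (Fin d) ℝ}
    (hp : polyLap p = 0) (h0 : ∀ x : Euc d, ‖x‖ = 1 → peval p x = 0) {x : Euc d} (hx : ‖x‖ < 1) :
    peval p x ≤ 0 := by
  by_contra! hpos
  set ε := peval p x / 2 with hε
  have hεpos : 0 < ε := half_pos hpos
  set v := p + ε • normSqPoly d with hv
  have hve : ∀ y, peval v y = peval p y + ε * ‖y‖ ^ 2 := by
    intro y
    rw [← peval_normSqPoly]
    simp [hv, peval]
  obtain ⟨y, hy, hmax⟩ := (isCompact_closedBall (0 : Euc d) 1).exists_isMaxOn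
    ⟨0, by simp⟩ (contDiff_peval (n := 0) v).continuous.continuousOn
  have hyx : peval v x ≤ peval v y := hmax (by simpa using hx.le)
  rw [mem_closedBall_zero_iff] at hy
  have hy1 : ‖y‖ < 1 := by
    refine lt_of_le_of_ne hy fun h => ?_
    rw [hve, hve, h0 y h, h] at hyx
    nlinarith [sq_nonneg ‖x‖]
  have hloc : IsLocalMax (peval v) y :=
    hmax.isLocalMax (closedBall_mem_nhds_of_mem (by simpa using hy1))
  have h1 := peval_polyLap_nonpos hloc
  have h2 : peval (polyLap v) y = ε * (2 * d) := by
    rw [hv, map_add, map_smul, hp, polyLap_normSqPoly]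
    simp [peval]
  rw [h2] at h1
  have : (0 : ℝ) < d := Nat.cast_pos.2 (Nat.pos_of_ne_zero (NeZero.ne d))
  nlinarith [mul_pos hεpos this]

theorem peval_one_sub_normSqPoly_mul (w : MvPolynomial (Fin d) ℝ) (x : Euc d) :
    peval ((1 - normSqPoly d) * w) x = (1 - ‖x‖ ^ 2) * peval w x := by
  rw [← peval_normSqPoly]
  simp [peval]

theorem eq_zero_of_polyLap_eq_zero [NeZero d] {w : MvPolynomial (Fin d) ℝ}
    (h : polyLap ((1 - normSqPoly d) * w) = 0) : w = 0 := by
  have hb : ∀ u : MvPolynomial (Fin d) ℝ, ∀ x : Euc d, ‖x‖ = 1 →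
      peval ((1 - normSqPoly d) * u) x = 0 := by
    intro u x hx
    rw [peval_one_sub_normSqPoly_mul, hx]; ring
  have hz : ∀ x : Euc d, ‖x‖ < 1 → peval w x = 0 := by
    intro x hx
    have h1 := peval_nonpos_of_polyLap_eq_zero h (hb w) hx
    have h' : polyLap ((1 - normSqPoly d) * (-w)) = 0 := by
      rw [mul_neg, map_neg, h, neg_zero]
    have h2 := peval_nonpos_of_polyLap_eq_zero h' (hb (-w)) hx
    rw [peval_one_sub_normSqPoly_mul] at h1 h2
    have h3 : peval (-w) x = - peval w x := by simp [peval]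
    rw [h3] at h2
    have h4 : 0 < 1 - ‖x‖ ^ 2 := by nlinarith [norm_nonneg x]
    nlinarith
  have hd : (0 : ℝ) < d := Nat.cast_pos.2 (Nat.pos_of_ne_zero (NeZero.ne d))
  refine MvPolynomial.funext_set (fun _ => Ioo (0 : ℝ) (1 / (d + 1))) (fun _ => ?_) fun x hx => ?_
  · exact Set.Ioo_infinite (by positivity)
  · have := hz (WithLp.toLp 2 x) ?_
    · simpa [peval] using this
    · have h1 : ‖(WithLp.toLp 2 x : Euc d)‖ ^ 2 < 1 := by
        rw [EuclideanSpace.norm_sq_eq]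
        have h2 : ∀ i, ‖x i‖ ^ 2 ≤ 1 / ((d : ℝ) + 1) := by
          intro i
          have h3 := hx i (mem_univ i)
          rw [Real.norm_eq_abs, sq_abs]
          have h4 : 1 / ((d : ℝ) + 1) ≤ 1 := by
            rw [div_le_one (by positivity)]; linarith
          nlinarith [h3.1, h3.2]
        calc ∑ i, ‖x i‖ ^ 2 ≤ ∑ _i : Fin d, 1 / ((d : ℝ) + 1) :=
              Finset.sum_le_sum fun i _ => h2 i
          _ = d / (d + 1) := by simp [div_eq_mul_inv]
          _ < 1 := by rw [div_lt_one (by positivity)]; linarith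
      nlinarith [norm_nonneg (WithLp.toLp 2 x : Euc d)]

/-- Every polynomial is the Laplacian of a polynomial multiple of `1 - ‖x‖ ^ 2`. -/
theorem exists_polyLap_eq [NeZero d] (q : MvPolynomial (Fin d) ℝ) :
    ∃ w, polyLap ((1 - normSqPoly d) * w) = q := by
  set n := q.totalDegree with hn
  let T : MvPolynomial (Fin d) ℝ →ₗ[ℝ] MvPolynomial (Fin d) ℝ :=
    polyLap ∘ₗ LinearMap.mulLeft ℝ (1 - normSqPoly d)
  have hT : ∀ w ∈ MvPolynomial.restrictTotalDegree (Fin d) ℝ n,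
      T w ∈ MvPolynomial.restrictTotalDegree (Fin d) ℝ n := by
    intro w hw
    rw [MvPolynomial.mem_restrictTotalDegree] at hw ⊢
    have h1 := totalDegree_polyLap_le ((1 - normSqPoly d) * w)
    have h2 := MvPolynomial.totalDegree_mul (1 - normSqPoly d) w
    have h3 := MvPolynomial.totalDegree_sub (1 : MvPolynomial (Fin d) ℝ) (normSqPoly d)
    have h4 := totalDegree_normSqPoly_le (d := d)
    have h5 : (1 : MvPolynomial (Fin d) ℝ).totalDegree = 0 := MvPolynomial.totalDegree_one
    have h6 : (1 - normSqPoly d).totalDegree ≤ 2 := h3.trans (by rw [h5]; simpa using h4)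
    change (polyLap ((1 - normSqPoly d) * w)).totalDegree ≤ n
    omega
  have hinj : Function.Injective (T.restrict hT) := by
    rw [injective_iff_map_eq_zero]
    intro w hw
    exact Subtype.ext (eq_zero_of_polyLap_eq_zero (congrArg Subtype.val hw))
  obtain ⟨w, hw⟩ := LinearMap.injective_iff_surjective.1 hinj
    ⟨q, (MvPolynomial.mem_restrictTotalDegree _ _ _).2 le_rfl⟩
  exact ⟨w.1, congrArg Subtype.val hw⟩

end dirichlet

/-! ### Approximation of polynomials by Laplacians of compactly supported functions -/

/-- A smooth function agreeing with the identity on `t ≤ 1 / 2` and vanishing on `1 ≤ t`. -/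
def truncId (t : ℝ) : ℝ := t * Real.smoothTransition (2 - 2 * t)

theorem contDiff_truncId {n : ℕ∞} : ContDiff ℝ n truncId :=
  contDiff_id.mul (Real.smoothTransition.contDiff.comp (by fun_prop))

theorem truncId_of_le {t : ℝ} (h : t ≤ 1 / 2) : truncId t = t := by
  rw [truncId, Real.smoothTransition.one_of_one_le (by linarith), mul_one]

theorem truncId_of_ge {t : ℝ} (h : 1 ≤ t) : truncId t = 0 := by
  rw [truncId, Real.smoothTransition.zero_of_nonpos (by linarith), mul_zero]

theorem exists_iteratedDeriv_truncId_le (n : ℕ) :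
    ∃ B, 0 ≤ B ∧ ∀ m ≤ n, ∀ t, 0 ≤ t → |iteratedDeriv m truncId t| ≤ B := by
  have h : ∀ m, ∃ B, ∀ t ∈ Icc (0 : ℝ) 2, ‖iteratedDeriv m truncId t‖ ≤ B := fun m =>
    isCompact_Icc.exists_bound_of_continuousOn
      ((contDiff_truncId (n := m)).continuous_iteratedDeriv m le_rfl).continuousOn
  choose B hB using h
  have hB0 : ∀ m, 0 ≤ B m := fun m => (norm_nonneg _).trans (hB m 0 (by simp))
  refine ⟨∑ m ∈ Finset.range (n + 1), B m, Finset.sum_nonneg fun m _ => hB0 m,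
    fun m hm t ht => ?_⟩
  have hle : B m ≤ ∑ m ∈ Finset.range (n + 1), B m :=
    Finset.single_le_sum (fun m _ => hB0 m) (Finset.mem_range.2 (by omega))
  refine le_trans ?_ hle
  rcases le_or_gt t 2 with h2 | h2
  · exact hB m t ⟨ht, h2⟩
  · have : truncId =ᶠ[𝓝 t] fun _ => 0 := by
      filter_upwards [lt_mem_nhds h2] with s hs using truncId_of_ge (by linarith)
    rw [this.iteratedDeriv_eq]
    simpa [iteratedDeriv_const] using hB0 m

theorem abs_lap_le {d : ℕ} (u : Euc d → ℝ) (x : Euc d) :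
    |lap u x| ≤ d * ‖iteratedFDeriv ℝ 2 u x‖ := by
  refine (Finset.abs_sum_le_sum_abs _ _).trans ?_
  calc _ ≤ ∑ _i : Fin d, ‖iteratedFDeriv ℝ 2 u x‖ := Finset.sum_le_sum fun i _ => by
        have := (iteratedFDeriv ℝ 2 u x).le_opNorm
          ![EuclideanSpace.single i 1, EuclideanSpace.single i 1]
        simpa using this
    _ = _ := by simp

theorem exists_lap_truncId_le {d : ℕ} {σ w : Euc d → ℝ} (hσ : IsTestFun σ) (hw : IsTestFun w) :
    ∃ C, ∀ δ, 0 < δ → δ ≤ 1 → ∀ x, 0 ≤ σ x →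
      |lap (fun y => δ * truncId (δ⁻¹ * σ y) * w y) x| ≤ C / δ := by
  obtain ⟨B, hB0, hB⟩ := exists_iteratedDeriv_truncId_le 2
  choose S hS0 hS using fun m => GFF.exists_iteratedFDeriv_bound hσ m
  choose W hW0 hW using fun m => GFF.exists_iteratedFDeriv_bound hw m
  set D := 1 + S 1 + S 2 with hD
  have hD1 : 1 ≤ D := by have := hS0 1; have := hS0 2; linarith
  refine ⟨d * ∑ i ∈ Finset.range 3, ((2 : ℕ).choose i : ℝ) * (i.factorial * B * D ^ i) *
    W (2 - i), fun δ hδ hδ1 x hx => ?_⟩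
  set ψ : ℝ → ℝ := fun t => δ * truncId (δ⁻¹ * t) with hψ
  have hψc : ContDiff ℝ (⊤ : ℕ∞) ψ :=
    contDiff_const.mul (contDiff_truncId.comp (contDiff_const.mul contDiff_id))
  have hψB : ∀ m ≤ 2, ‖iteratedFDeriv ℝ m ψ (σ x)‖ ≤ B / δ := by
    intro m hm
    rw [norm_iteratedFDeriv_eq_norm_iteratedDeriv, hψ, iteratedDeriv_const_mul_field,
      iteratedDeriv_comp_const_mul contDiff_truncId]
    have h1 := hB m hm (δ⁻¹ * σ x) (by positivity)
    rw [Real.norm_eq_abs, abs_mul, abs_mul, abs_of_pos hδ, abs_of_pos (by positivity)]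
    have h2 : δ * (δ⁻¹) ^ m ≤ 1 / δ := by
      have : δ * (δ⁻¹) ^ m = δ * (δ ^ (2 - m)) / δ ^ 2 := by
        rw [inv_pow, ← div_eq_mul_inv, div_eq_div_iff (by positivity) (by positivity), mul_assoc,
          ← pow_add, Nat.sub_add_cancel hm]
      rw [this, div_le_div_iff₀ (by positivity) hδ]
      have h3 : δ ^ (2 - m) ≤ 1 := pow_le_one₀ hδ.le hδ1
      nlinarith [sq_nonneg δ]
    rw [← mul_assoc]
    calc _ ≤ 1 / δ * B := by gcongr
      _ = B / δ := by ring
  have hcomp : ∀ i ≤ 2, ‖iteratedFDeriv ℝ i (ψ ∘ σ) x‖ ≤ i.factorial * (B / δ) * D ^ i := by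
    intro i hi
    refine norm_iteratedFDeriv_comp_le hψc hσ.1 (WithTop.coe_le_coe.2 le_top) x
      (fun j hj => hψB j (hj.trans hi)) fun j hj1 hji => ?_
    refine (hS j x).trans ?_
    have h1 := hS0 1
    have h2 := hS0 2
    have : S j ≤ D := by
      obtain rfl | rfl : j = 1 ∨ j = 2 := by omega
      · linarith
      · linarith
    exact this.trans (le_self_pow₀ hD1 (by omega))
  have hmul := norm_iteratedFDeriv_mul_le (hψc.comp hσ.1) hw.1 x (n := 2)
    (WithTop.coe_le_coe.2 le_top)
  refine (abs_lap_le _ x).trans ?_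
  rw [mul_div_assoc, Finset.sum_div]
  refine mul_le_mul_of_nonneg_left (hmul.trans (Finset.sum_le_sum fun i hi => ?_))
    (Nat.cast_nonneg _)
  have hi2 : i ≤ 2 := by have := Finset.mem_range.1 hi; omega
  calc _ ≤ ((2 : ℕ).choose i : ℝ) * (i.factorial * (B / δ) * D ^ i) * W (2 - i) :=
        mul_le_mul (mul_le_mul_of_nonneg_left (hcomp i hi2) (Nat.cast_nonneg _)) (hW _ x)
          (norm_nonneg _) (by positivity)
    _ = _ := by ring

namespace GFF

variable {d : ℕ} {Ω : Type} [MeasurableSpace Ω] {X : GFF d Ω}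

/-- Polynomials are limits of Laplacians of test functions supported in the unit ball. -/
theorem exists_N_polyTest_sub_lap_le (hd : 2 ≤ d) (q : MvPolynomial (Fin d) ℝ) {ε : ℝ}
    (hε : 0 < ε) :
    ∃ g, IsTestFun g ∧ tsupport g ⊆ ball 0 1 ∧ X.N (polyTest q - lap g) ≤ ε := by
  have : NeZero d := ⟨by omega⟩
  obtain ⟨w, hw⟩ := exists_polyLap_eq q
  set σ : Euc d → ℝ := polyTest (1 - normSqPoly d) with hσ
  have hσt : IsTestFun σ := isTestFun_polyTest _
  have hpe : ∀ x, peval (1 - normSqPoly d) x = 1 - ‖x‖ ^ 2 := fun x => by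
    rw [← peval_normSqPoly]; simp [peval]
  have hσ1 : ∀ x, ‖x‖ ≤ 2 → σ x = 1 - ‖x‖ ^ 2 := fun x hx => by
    rw [hσ, polyTest_apply hx, hpe]
  have hσ2 : ∀ x, 1 ≤ ‖x‖ → σ x ≤ 0 := fun x hx => by
    rw [hσ, polyTest, Pi.mul_apply, hpe]
    exact mul_nonpos_of_nonneg_of_nonpos radialCutoff_nonneg (by nlinarith)
  obtain ⟨C, hC⟩ := exists_lap_truncId_le hσt (isTestFun_polyTest w)
  obtain ⟨δ₀, hδ₀, hlay⟩ := exists_layer_bound hd X C hε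
  set δ := min (δ₀ / 2) (1 / 2) with hδ
  have hδpos : 0 < δ := by positivity
  have hδ2 : δ ≤ 1 / 2 := min_le_right _ _
  have hδlt : δ < δ₀ := (min_le_left _ _).trans_lt (by linarith)
  set V : Euc d → ℝ := fun y => δ * truncId (δ⁻¹ * σ y) * polyTest w y with hV
  have hVt : IsTestFun V := by
    refine IsTestFun.mul_left (f := fun y => δ * truncId (δ⁻¹ * σ y)) ?_ (isTestFun_polyTest w)
    exact contDiff_const.mul (contDiff_truncId.comp (contDiff_const.mul hσt.1))
  set g : Euc d → ℝ := σ * polyTest w - V with hg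
  have hσw : IsTestFun (σ * polyTest w) := hσt.mul_right (isTestFun_polyTest w).1
  have hgt : IsTestFun g := hσw.sub hVt
  have hgs : tsupport g ⊆ {x | δ / 2 ≤ σ x} := by
    refine closure_minimal (fun x hx => ?_) (isClosed_le continuous_const hσt.1.continuous)
    by_contra! hlt
    refine hx ?_
    have h1 : δ⁻¹ * σ x ≤ 1 / 2 := by
      rw [inv_mul_le_iff₀ hδpos]; simp only [mem_ofPred_eq, not_le] at hlt; linarith
    simp only [hg, hV, Pi.sub_apply, Pi.mul_apply, truncId_of_le h1]
    field_simp
    ring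
  have hlapσ : ∀ x : Euc d, ‖x‖ < 1 → lap (σ * polyTest w) x = polyTest q x := by
    intro x hx
    have h1 : σ * polyTest w =ᶠ[𝓝 x] peval ((1 - normSqPoly d) * w) := by
      filter_upwards [isOpen_ball.mem_nhds (show x ∈ ball (0 : Euc d) 1 by simpa using hx)]
        with y hy
      have hy2 : ‖y‖ ≤ 2 := by rw [mem_ball_zero_iff] at hy; linarith
      rw [Pi.mul_apply, hσ1 y hy2, polyTest_apply hy2, peval_one_sub_normSqPoly_mul]
    rw [lap_congr h1, lap_peval, hw, polyTest_apply (by linarith)]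
  have hE : ∀ x : Euc d, ‖x‖ < 1 → (polyTest q - lap g) x = lap V x := by
    intro x hx
    have h1 : σ * polyTest w = g + V := by rw [hg]; abel
    have h2 := hlapσ x hx
    rw [h1, lap_add hgt.contDiff_two hVt.contDiff_two] at h2
    rw [Pi.sub_apply, ← h2, Pi.add_apply]
    ring
  refine ⟨g, hgt, hgs.trans fun x hx => ?_, ?_⟩
  · rw [mem_ball_zero_iff]
    by_contra! h
    have := hσ2 x h
    simp only [mem_ofPred_eq] at hx
    linarith
  · refine hlay δ hδpos hδlt _ ((isTestFun_polyTest q).sub hgt.lap) (fun x hx => ?_)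
      fun x hx => ?_
    · rw [hE x hx]
      refine hC δ hδpos (by linarith) x ?_
      rw [hσ1 x (by linarith)]
      nlinarith [norm_nonneg x]
    · rw [hE x (by linarith)]
      have h1 : V =ᶠ[𝓝 x] 0 := by
        filter_upwards [isOpen_ball.mem_nhds
          (show x ∈ ball (0 : Euc d) (1 - δ) by simpa using hx)] with y hy
        rw [mem_ball_zero_iff] at hy
        have h2 : 1 ≤ δ⁻¹ * σ y := by
          rw [hσ1 y (by linarith), ← div_eq_inv_mul, le_div_iff₀ hδpos]
          nlinarith [norm_nonneg y]
        simp [hV, truncId_of_ge h2]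
      rw [lap_congr h1, lap_zero]

/-- The interaction of two test functions with disjoint supports does not depend on polynomials. -/
theorem c_polyTest_add_mul (hd : 2 ≤ d) (q : MvPolynomial (Fin d) ℝ) {f₂ f₃ : Euc d → ℝ}
    (hf₂ : IsTestFun f₂) (hf₃ : IsTestFun f₃) (hdis : Disjoint (tsupport f₂) (tsupport f₃)) :
    X.c (polyTest q + f₂ + f₃) * X.c (polyTest q) * X.c f₂ * X.c f₃ =
      X.c (polyTest q + f₂) * X.c (polyTest q + f₃) * X.c (f₂ + f₃) := by
  choose g hg hgs hgN using fun n : ℕ => exists_N_polyTest_sub_lap_le (X := X) hd q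
    (ε := 1 / ((n : ℝ) + 1)) (by positivity)
  have hlim : ∀ e, IsTestFun e →
      Tendsto (fun n => X.c (lap (g n) + e)) atTop (𝓝 (X.c (polyTest q + e))) := by
    intro e he
    rw [tendsto_iff_norm_sub_tendsto_zero]
    refine squeeze_zero (fun _ => norm_nonneg _) (fun n => ?_)
      tendsto_one_div_add_atTop_nhds_zero_nat
    rw [norm_sub_rev]
    refine (norm_c_sub_le ((isTestFun_polyTest q).add he) ((hg n).lap.add he)).trans ?_
    rw [add_sub_add_right_eq_sub]
    exact hgN n
  have hid : ∀ n, X.c (lap (g n) + (f₂ + f₃)) * X.c (lap (g n) + 0) * X.c f₂ * X.c f₃ =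
      X.c (lap (g n) + f₂) * X.c (lap (g n) + f₃) * X.c (f₂ + f₃) := by
    intro n
    have h := Q_add_lap (X := X) hd isTestFun_zero hf₂ hf₃ hdis (hg n) (hgs n)
    simp only [Q, zero_add, c_zero, mul_one] at h
    rw [div_eq_div_iff (mul_ne_zero (c_ne_zero hd ((hg n).lap.add hf₂))
      (c_ne_zero hd ((hg n).lap.add hf₃))) (mul_ne_zero (c_ne_zero hd hf₂) (c_ne_zero hd hf₃))]
      at h
    rw [add_zero, ← add_assoc]
    linear_combination h
  have h1 := (((hlim _ (hf₂.add hf₃)).mul (hlim 0 isTestFun_zero)).mul_const (X.c f₂)).mul_const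
    (X.c f₃)
  have h2 := ((hlim _ hf₂).mul (hlim _ hf₃)).mul_const (X.c (f₂ + f₃))
  simp only [hid] at h1
  have := tendsto_nhds_unique h1 h2
  rwa [add_zero, ← add_assoc] at this

end GFF

/-! ### The cubic interaction of dilated polynomials is constant -/

theorem norm_mul_sub_mul_le_of_norm_le_one {x y x' y' : ℂ} {s t : ℝ} (hy : ‖y‖ ≤ 1)
    (hx' : ‖x'‖ ≤ 1) (hs : ‖x - x'‖ ≤ s) (ht : ‖y - y'‖ ≤ t) : ‖x * y - x' * y'‖ ≤ s + t := by
  have e : x * y - x' * y' = (x - x') * y + x' * (y - y') := by ring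
  rw [e]
  refine (norm_add_le _ _).trans ?_
  rw [norm_mul, norm_mul]
  exact add_le_add ((mul_le_of_le_one_right (norm_nonneg _) hy).trans hs)
    ((mul_le_of_le_one_left (norm_nonneg _) hx').trans ht)

theorem tsupport_scl_subset {d : ℕ} (a : Euc d) (r : ℝ) (f : Euc d → ℝ) :
    tsupport (scl a r f) ⊆ (fun x => a + r • x) ⁻¹' tsupport f :=
  (closure_mono (Function.support_const_smul_subset _ _)).trans
    (tsupport_comp_subset_preimage f (by fun_prop))

namespace GFF

variable {d : ℕ} {Ω : Type} [MeasurableSpace Ω] {X : GFF d Ω}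

theorem β_polyTest_add_mul (hd : 2 ≤ d) {r : ℝ} (hr : 0 < r) (hr1 : r ≤ 1)
    (q : MvPolynomial (Fin d) ℝ) {f₂ f₃ : Euc d → ℝ}
    (hf₂ : IsTestFun f₂) (hf₃ : IsTestFun f₃) (hdis : Disjoint (tsupport f₂) (tsupport f₃)) :
    X.β 0 r (polyTest q + f₂ + f₃) * X.β 0 r (polyTest q) * X.β 0 r f₂ * X.β 0 r f₃ =
      X.β 0 r (polyTest q + f₂) * X.β 0 r (polyTest q + f₃) * X.β 0 r (f₂ + f₃) := by
  have hb := ball_subset_of_le (d := d) hr1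
  have hq := isTestFun_polyTest q
  have hP : ∀ e, IsTestFun e →
      X.c (scl 0 r (polyTest q + e)) = X.c (polyTest (dil r q) + scl 0 r e) := by
    intro e he
    refine c_congr ((hq.add he).scl 0 hr) ((isTestFun_polyTest _).add (he.scl 0 hr))
      fun x hx => ?_
    rw [scl_add, Pi.add_apply, Pi.add_apply, scl_polyTest q hr hr1 hx]
  have hdis' : Disjoint (tsupport (scl 0 r f₂)) (tsupport (scl 0 r f₃)) :=
    (hdis.preimage _).mono (tsupport_scl_subset _ _ _) (tsupport_scl_subset _ _ _)
  have h1 := c_polyTest_add_mul (X := X) hd q hf₂ hf₃ hdis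
  have h2 := c_polyTest_add_mul (X := X) hd (dil r q) (hf₂.scl 0 hr) (hf₃.scl 0 hr) hdis'
  rw [c_polyTest_eq hr hr1, add_assoc, c_eq_mul_β hr hb (hq.add (hf₂.add hf₃)),
    c_eq_mul_β hr hb (hq.add hf₂), c_eq_mul_β hr hb (hq.add hf₃), c_eq_mul_β hr hb hf₂,
    c_eq_mul_β hr hb hf₃, c_eq_mul_β hr hb (hf₂.add hf₃), hP _ (hf₂.add hf₃), hP _ hf₂,
    hP _ hf₃, scl_add] at h1
  rw [add_assoc] at h2 ⊢
  have hne : X.c (polyTest (dil r q) + scl 0 r f₂) * X.c (polyTest (dil r q) + scl 0 r f₃) *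
      X.c (scl 0 r f₂ + scl 0 r f₃) ≠ 0 := by
    have hp := isTestFun_polyTest (dil r q)
    exact mul_ne_zero (mul_ne_zero (c_ne_zero hd (hp.add (hf₂.scl 0 hr)))
      (c_ne_zero hd (hp.add (hf₃.scl 0 hr)))) (c_ne_zero hd ((hf₂.scl 0 hr).add (hf₃.scl 0 hr)))
  refine mul_left_cancel₀ hne ?_
  linear_combination h1 - (X.β 0 r (polyTest q + (f₂ + f₃)) * X.β 0 r (polyTest q) *
    X.β 0 r f₂ * X.β 0 r f₃) * h2

/-- A polynomial is a Laplacian inside the ball plus a function supported in a thin shell, up to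
an error negligible compared with the thickness of the shell. -/
theorem exists_shell (hd : 2 ≤ d) (q : MvPolynomial (Fin d) ℝ) {k : ℝ} (hk : 0 ≤ k) {ε : ℝ}
    (hε : 0 < ε) :
    ∃ δ₀ > 0, ∀ δ, 0 < δ → δ < δ₀ → ∃ s g, IsTestFun s ∧ IsTestFun g ∧
      (∀ x ∈ tsupport s, 1 - (k + 1) * δ ≤ ‖x‖ ∧ ‖x‖ ≤ 1 - k * δ) ∧
      (∀ x ∈ tsupport g, ‖x‖ ≤ 1 - k * δ) ∧ X.N (polyTest q - (s + lap g)) ≤ ε * δ := by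
  have : NeZero d := ⟨by omega⟩
  obtain ⟨w, hw⟩ := exists_polyLap_eq q
  set G : Euc d → ℝ := polyTest ((1 - normSqPoly d) * w) with hG
  have hGt : IsTestFun G := isTestFun_polyTest _
  set P : Euc d → ℝ := polyTest q with hP
  have hPt : IsTestFun P := isTestFun_polyTest _
  obtain ⟨M, hM⟩ := hPt.2.exists_bound_of_continuous hPt.1.continuous
  obtain ⟨δ₀, hδ₀, hlay⟩ := exists_layer_bound hd X M (ε := ε / (k + 1)) (by positivity)
  refine ⟨min δ₀ 1 / (k + 1), by positivity, fun δ hδ hδlt => ?_⟩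
  rw [lt_div_iff₀ (by positivity), mul_comm] at hδlt
  set ρ := (k + 1) * δ with hρ
  have hρ0 : 0 < ρ := by positivity
  have hρ1 : ρ < 1 := hδlt.trans_le (min_le_right _ _)
  have hρe : 1 - k * δ = 1 - ρ + δ := by rw [hρ]; ring
  set χ : Euc d → ℝ := radialCutoff (1 - ρ) (1 - k * δ) with hχ
  have hlt : 1 - ρ < 1 - k * δ := by rw [hρe]; linarith
  have hχt : IsTestFun χ := isTestFun_radialCutoff (by linarith) hlt
  have hχ1 : ∀ x : Euc d, ‖x‖ < 1 - ρ → χ x = 1 := fun x hx =>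
    radialCutoff_eq_one (by linarith) hlt hx.le
  have hχ0 : ∀ x : Euc d, 1 - k * δ < ‖x‖ → χ x = 0 := fun x hx =>
    radialCutoff_eq_zero (by linarith) hlt hx.le
  have hgt : IsTestFun (χ * G) := IsTestFun.mul_left hχt.1 hGt
  have hχP : IsTestFun (χ * P) := IsTestFun.mul_left hχt.1 hPt
  have hgs : ∀ x ∈ tsupport (χ * G), ‖x‖ ≤ 1 - k * δ := by
    have : tsupport (χ * G) ⊆ closedBall 0 (1 - k * δ) := by
      refine closure_minimal (fun x hx => ?_) isClosed_closedBall
      by_contra h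
      rw [mem_closedBall_zero_iff, not_le] at h
      exact hx (by rw [Pi.mul_apply, hχ0 x h, zero_mul])
    exact fun x hx => mem_closedBall_zero_iff.1 (this hx)
  have hlapG : ∀ x : Euc d, ‖x‖ < 1 - ρ → lap (χ * G) x = P x := by
    intro x hx
    have h1 : χ * G =ᶠ[𝓝 x] peval ((1 - normSqPoly d) * w) := by
      filter_upwards [isOpen_ball.mem_nhds
        (show x ∈ ball (0 : Euc d) (1 - ρ) by simpa using hx)] with y hy
      rw [mem_ball_zero_iff] at hy
      rw [Pi.mul_apply, hχ1 y hy, one_mul, hG, polyTest_apply (by linarith)]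
    rw [lap_congr h1, lap_peval, hw, hP, polyTest_apply (by linarith)]
  refine ⟨χ * P - lap (χ * G), χ * G, hχP.sub hgt.lap, hgt, fun x hx => ?_, hgs, ?_⟩
  · have hcl : IsClosed {x : Euc d | 1 - ρ ≤ ‖x‖ ∧ ‖x‖ ≤ 1 - k * δ} :=
      (isClosed_le continuous_const continuous_norm).inter
        (isClosed_le continuous_norm continuous_const)
    refine closure_minimal (fun y hy => ?_) hcl hx
    by_contra h
    refine hy ?_
    rw [Pi.sub_apply, Pi.mul_apply]
    rcases lt_or_ge ‖y‖ (1 - ρ) with h1 | h1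
    · rw [hχ1 y h1, hlapG y h1]; ring
    · have h2 : 1 - k * δ < ‖y‖ := by
        by_contra! h3
        exact h ⟨h1, h3⟩
      rw [hχ0 y h2, lap_eq_zero_of_notMem_tsupport fun h3 => (hgs y h3).not_gt h2]; ring
  · have e1 : P - (χ * P - lap (χ * G) + lap (χ * G)) = ρ • (ρ⁻¹ • (P - χ * P)) := by
      rw [smul_smul, mul_inv_cancel₀ hρ0.ne', one_smul, sub_add_cancel]
    have ht : IsTestFun (P - χ * P) := hPt.sub hχP
    rw [e1, N_smul _ (ht.smul _), abs_of_pos hρ0]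
    have h1 : X.N (ρ⁻¹ • (P - χ * P)) ≤ ε / (k + 1) := by
      refine hlay ρ hρ0 (hδlt.trans_le (min_le_left _ _)) _ (ht.smul _) (fun x _ => ?_)
        fun x hx => ?_
      · have e2 : (ρ⁻¹ • (P - χ * P)) x = ρ⁻¹ * ((1 - χ x) * P x) := by
          simp only [Pi.smul_apply, Pi.sub_apply, Pi.mul_apply, smul_eq_mul]; ring
        rw [e2, abs_mul, abs_mul, abs_of_pos (inv_pos.2 hρ0),
          abs_of_nonneg (sub_nonneg.2 radialCutoff_le_one), div_eq_inv_mul]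
        have h3 : 1 - χ x ≤ 1 := sub_le_self _ radialCutoff_nonneg
        have h4 := hM x
        rw [Real.norm_eq_abs] at h4
        refine mul_le_mul_of_nonneg_left ?_ (inv_pos.2 hρ0).le
        exact (mul_le_of_le_one_left (abs_nonneg _) h3).trans h4
      · simp [hχ1 x hx]
    calc ρ * X.N (ρ⁻¹ • (P - χ * P)) ≤ ρ * (ε / (k + 1)) := by gcongr
      _ = ε * δ := by rw [hρ]; field_simp

theorem norm_β_add_smul_sub_le {r : ℝ} (hr : 0 < r) (hb : ball 0 r ⊆ ball (0 : Euc d) 1)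
    {P s g : Euc d → ℝ} (hP : IsTestFun P) (hs : IsTestFun s) (hg : IsTestFun g)
    (hgs : tsupport g ⊆ ball 0 r) (b : ℝ) {e : Euc d → ℝ} (he : IsTestFun e) :
    ‖X.β 0 r (e + b • s) - X.β 0 r (e + b • P)‖ ≤ |b| * X.N (P - (s + lap g)) := by
  have hbg : tsupport (b • g) ⊆ ball 0 r :=
    (closure_mono (Function.support_const_smul_subset _ _)).trans hgs
  rw [← β_add_lap (X := X) hr hb (he.add (hs.smul b)) (hg.smul b) hbg]
  have ht : IsTestFun (P - (s + lap g)) := hP.sub (hs.add hg.lap)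
  refine (norm_β_sub_le hr hb ((he.add (hs.smul b)).add (hg.smul b).lap)
    (he.add (hP.smul b))).trans ?_
  rw [← abs_neg, ← N_smul _ ht, lap_smul b hg.contDiff_two]
  refine le_of_eq (congrArg _ ?_)
  ext x
  simp only [Pi.add_apply, Pi.sub_apply, Pi.smul_apply, smul_eq_mul]
  ring

/-- The cubic interaction of the harmonic part on a ball of radius `1 - δ` is `1 + o(δ)`. -/
theorem exists_norm_β_cubic_sub_le (hd : 2 ≤ d) (q : MvPolynomial (Fin d) ℝ) (a b c : ℝ) {ε : ℝ}
    (hε : 0 < ε) :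
    ∃ δ₀ > 0, ∀ δ, 0 < δ → δ < δ₀ →
      ‖X.β 0 (1 - δ) ((a + b + c) • polyTest q) * X.β 0 (1 - δ) (a • polyTest q) *
        X.β 0 (1 - δ) (b • polyTest q) * X.β 0 (1 - δ) (c • polyTest q) -
        X.β 0 (1 - δ) ((a + b) • polyTest q) * X.β 0 (1 - δ) ((a + c) • polyTest q) *
        X.β 0 (1 - δ) ((b + c) • polyTest q)‖ ≤ ε * δ := by
  set K := 4 * (|b| + |c|) + 1 with hK
  have hK0 : 0 < K := by positivity
  obtain ⟨δ₂, hδ₂, h₂⟩ := exists_shell (X := X) hd q (k := 2) (by norm_num)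
    (ε := ε / K) (by positivity)
  obtain ⟨δ₃, hδ₃, h₃⟩ := exists_shell (X := X) hd q (k := 4) (by norm_num)
    (ε := ε / K) (by positivity)
  refine ⟨min (min δ₂ δ₃) (1 / 2), by positivity, fun δ hδ hlt => ?_⟩
  have hlt1 : δ < 1 / 2 := hlt.trans_le (min_le_right _ _)
  obtain ⟨s₂, g₂, hs₂, hg₂, hs₂s, hg₂s, hN₂⟩ := h₂ δ hδ
    (hlt.trans_le ((min_le_left _ _).trans (min_le_left _ _)))
  obtain ⟨s₃, g₃, hs₃, hg₃, hs₃s, hg₃s, hN₃⟩ := h₃ δ hδ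
    (hlt.trans_le ((min_le_left _ _).trans (min_le_right _ _)))
  set r := 1 - δ with hr
  have hr0 : 0 < r := by linarith
  have hr1 : r ≤ 1 := by linarith
  have hb := ball_subset_of_le (d := d) hr1
  set P : Euc d → ℝ := polyTest q with hP
  have hPt : IsTestFun P := isTestFun_polyTest _
  have hdis : Disjoint (tsupport (b • s₂)) (tsupport (c • s₃)) := by
    rw [disjoint_left]
    intro x hx2 hx3
    have h1 := hs₂s x (closure_mono (Function.support_const_smul_subset _ _) hx2)
    have h2 := hs₃s x (closure_mono (Function.support_const_smul_subset _ _) hx3)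
    linarith [h1.1, h2.2]
  have hg2b : tsupport g₂ ⊆ ball 0 r := fun x hx => by
    have := hg₂s x hx
    rw [mem_ball_zero_iff]; linarith
  have hg3b : tsupport g₃ ⊆ ball 0 r := fun x hx => by
    have := hg₃s x hx
    rw [mem_ball_zero_iff]; linarith
  have hid := β_polyTest_add_mul (X := X) hd hr0 hr1 (a • q) (hs₂.smul b) (hs₃.smul c) hdis
  rw [polyTest_smul, ← hP] at hid
  have haP := hPt.smul a
  have hbP := hPt.smul b
  have hb2 := hs₂.smul b
  have hc3 := hs₃.smul c
  set η₂ := |b| * (ε / K * δ) with hη₂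
  set η₃ := |c| * (ε / K * δ) with hη₃
  have E2 : ∀ e, IsTestFun e → ‖X.β 0 r (e + b • s₂) - X.β 0 r (e + b • P)‖ ≤ η₂ := fun e he =>
    (norm_β_add_smul_sub_le hr0 hb hPt hs₂ hg₂ hg2b b he).trans
      (mul_le_mul_of_nonneg_left hN₂ (abs_nonneg _))
  have E3 : ∀ e, IsTestFun e → ‖X.β 0 r (e + c • s₃) - X.β 0 r (e + c • P)‖ ≤ η₃ := fun e he =>
    (norm_β_add_smul_sub_le hr0 hb hPt hs₃ hg₃ hg3b c he).trans
      (mul_le_mul_of_nonneg_left hN₃ (abs_nonneg _))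
  have E2' := E2 0 isTestFun_zero
  have E3' := E3 0 isTestFun_zero
  rw [zero_add, zero_add] at E2' E3'
  have E23 : ∀ e, IsTestFun e →
      ‖X.β 0 r (e + b • s₂ + c • s₃) - X.β 0 r (e + b • P + c • P)‖ ≤ η₂ + η₃ := by
    intro e he
    have h1 := E3 (e + b • s₂) (he.add hb2)
    have h2 := E2 (e + c • P) (he.add (hPt.smul c))
    rw [add_right_comm e, add_right_comm e (c • P)] at h2
    calc _ ≤ _ := norm_sub_le_norm_sub_add_norm_sub _ (X.β 0 r (e + b • s₂ + c • P)) _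
      _ ≤ _ := by linarith
  have E23' := E23 0 isTestFun_zero
  rw [zero_add, zero_add] at E23'
  have hone : ∀ e, ‖X.β 0 r e‖ ≤ 1 := fun e => norm_β_le_one
  have mul1 : ∀ {x y : ℂ}, ‖x‖ ≤ 1 → ‖y‖ ≤ 1 → ‖x * y‖ ≤ 1 := fun hx hy => by
    rw [norm_mul]; exact mul_le_one₀ hx (norm_nonneg _) hy
  have hnum := norm_mul_sub_mul_le_of_norm_le_one (hone _)
    (mul1 (mul1 (hone (a • P + b • P + c • P)) (hone (a • P))) (hone (b • P)))
    (norm_mul_sub_mul_le_of_norm_le_one (hone _) (mul1 (hone _) (hone _))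
      (norm_mul_sub_mul_le_of_norm_le_one (hone _) (hone _) (E23 _ haP)
        (le_of_eq (by rw [sub_self, norm_zero]) : ‖X.β 0 r (a • P) - X.β 0 r (a • P)‖ ≤ 0)) E2')
    E3'
  have hden := norm_mul_sub_mul_le_of_norm_le_one (hone _) (mul1 (hone _) (hone _))
    (norm_mul_sub_mul_le_of_norm_le_one (hone _) (hone _) (E2 _ haP) (E3 _ haP)) E23'
  rw [hid] at hnum
  simp only [add_smul]
  have hfin : (η₂ + η₃ + 0 + η₂ + η₃) + (η₂ + η₃ + (η₂ + η₃)) ≤ ε * δ := by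
    have : (η₂ + η₃ + 0 + η₂ + η₃) + (η₂ + η₃ + (η₂ + η₃)) = (K - 1) * (ε / K * δ) := by
      rw [hη₂, hη₃, hK]; ring
    rw [this]
    have h5 : K * (ε / K * δ) = ε * δ := by field_simp
    have h6 : 0 ≤ ε / K * δ := by positivity
    linarith
  refine le_trans ?_ hfin
  rw [norm_sub_rev] at hnum
  refine (norm_sub_le_norm_sub_add_norm_sub _ _ _).trans (add_le_add hnum hden)

end GFF

namespace GFF

variable {d : ℕ} {Ω : Type} [MeasurableSpace Ω] {X : GFF d Ω}

theorem c_smul_polyTest_dil_eq {t r : ℝ} (ht : 0 ≤ t) (hr : 0 < r) (hr1 : r ≤ 1)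
    (p : MvPolynomial (Fin d) ℝ) (a : ℝ) :
    X.c (a • polyTest (dil t p)) =
      X.c (a • polyTest (dil (t * r) p)) * X.β 0 r (a • polyTest (dil t p)) := by
  have h := c_polyTest_eq (X := X) hr hr1 (dil t (a • p))
  rw [polyTest_dil_dil _ hr.le ht, dil_smul, dil_smul, polyTest_smul, polyTest_smul] at h
  exact h

/-- The characteristic functional along a polynomial test function satisfies the functional
equation of centered Gaussian laws. -/
theorem c_smul_polyTest_cubic (hd : 2 ≤ d) (p : MvPolynomial (Fin d) ℝ) (a b c : ℝ) :
    X.c ((a + b + c) • polyTest p) * X.c (a • polyTest p) * X.c (b • polyTest p) *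
      X.c (c • polyTest p) =
    X.c ((a + b) • polyTest p) * X.c ((a + c) • polyTest p) * X.c ((b + c) • polyTest p) := by
  set z : ℝ → ℝ → ℂ := fun t e => X.c (e • polyTest (dil t p)) with hz
  set num : ℝ → ℂ := fun t => z t (a + b + c) * z t a * z t b * z t c with hnum
  set den : ℝ → ℂ := fun t => z t (a + b) * z t (a + c) * z t (b + c) with hden
  have hzc : ∀ e, Continuous fun t => z t e := fun e => continuous_c_smul_polyTest_dil p e
  have hz0 : ∀ t e, z t e ≠ 0 := fun t e => c_ne_zero hd ((isTestFun_polyTest _).smul e)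
  have hz1 : ∀ t e, ‖z t e‖ ≤ 1 := fun t e => norm_c_le_one
  have hden0 : ∀ t, den t ≠ 0 := fun t =>
    mul_ne_zero (mul_ne_zero (hz0 _ _) (hz0 _ _)) (hz0 _ _)
  have hnum1 : ∀ t, ‖num t‖ ≤ 1 := fun t => by
    simp only [hnum, norm_mul]
    exact mul_le_one₀ (mul_le_one₀ (mul_le_one₀ (hz1 _ _) (norm_nonneg _) (hz1 _ _))
      (norm_nonneg _) (hz1 _ _)) (norm_nonneg _) (hz1 _ _)
  have hnumc : Continuous num := (((hzc _).mul (hzc _)).mul (hzc _)).mul (hzc _)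
  have hdenc : Continuous den := ((hzc _).mul (hzc _)).mul (hzc _)
  set R : ℝ → ℂ := fun u => num (1 - u) / den (1 - u) with hR
  have hRc : Continuous R := by
    have h1 : Continuous fun u : ℝ => 1 - u := by fun_prop
    exact (hnumc.comp h1).div (hdenc.comp h1) fun u => hden0 _
  have hderiv : ∀ u ∈ Ico (0 : ℝ) 1, HasDerivWithinAt R 0 (Ici u) u := by
    intro u hu
    rw [hasDerivWithinAt_iff_isLittleO, Asymptotics.isLittleO_iff]
    intro ε hε
    set t := 1 - u with ht
    have ht0 : 0 < t := by linarith [hu.2]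
    obtain ⟨δ₀, hδ₀, hcub⟩ := exists_norm_β_cubic_sub_le (X := X) hd (dil t p) a b c
      (ε := ε * t * ‖den t‖) (by have := norm_pos_iff.2 (hden0 t); positivity)
    have hmem : Ico u (u + t * min δ₀ 1) ∈ 𝓝[≥] u :=
      Ico_mem_nhdsGE (by linarith [mul_pos ht0 (lt_min hδ₀ one_pos)])
    filter_upwards [hmem] with v hv
    rw [smul_zero, sub_zero, Real.norm_of_nonneg (sub_nonneg.2 hv.1)]
    rcases hv.1.eq_or_lt with rfl | huv
    · simp
    set δ := (v - u) / t with hδ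
    have hδpos : 0 < δ := div_pos (by linarith) ht0
    have hδt : t * δ = v - u := by rw [hδ]; field_simp
    have hδlt : δ < min δ₀ 1 := by
      rw [hδ, div_lt_iff₀ ht0]; linarith [hv.2]
    have hδlt1 := hδlt.trans_le (min_le_right _ _)
    have hcub' := hcub δ hδpos (hδlt.trans_le (min_le_left _ _))
    have hv' : 1 - v = t * (1 - δ) := by rw [mul_sub, hδt, ht]; ring
    have hzt : ∀ e, z t e = z (1 - v) e * X.β 0 (1 - δ) (e • polyTest (dil t p)) := fun e => by
      rw [hv']
      exact c_smul_polyTest_dil_eq ht0.le (by linarith) (by linarith) p e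
    set A := X.β 0 (1 - δ) ((a + b + c) • polyTest (dil t p)) *
      X.β 0 (1 - δ) (a • polyTest (dil t p)) * X.β 0 (1 - δ) (b • polyTest (dil t p)) *
      X.β 0 (1 - δ) (c • polyTest (dil t p)) with hA
    set B := X.β 0 (1 - δ) ((a + b) • polyTest (dil t p)) *
      X.β 0 (1 - δ) ((a + c) • polyTest (dil t p)) *
      X.β 0 (1 - δ) ((b + c) • polyTest (dil t p)) with hB
    have hnt : num t = num (1 - v) * A := by
      simp only [hnum, hA, hzt]; ring
    have hdt : den t = den (1 - v) * B := by
      simp only [hden, hB, hzt]; ring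
    have hB0 : B ≠ 0 := fun h => hden0 t (by rw [hdt, h, mul_zero])
    have hRe : R v - R u = -(num (1 - v) * (A - B)) / den t := by
      have h0 := hden0 (1 - v)
      simp only [hR]
      rw [← ht, hnt, hdt]
      field_simp
      ring
    rw [hRe, norm_div, norm_neg, norm_mul, div_le_iff₀ (norm_pos_iff.2 (hden0 t))]
    calc ‖num (1 - v)‖ * ‖A - B‖ ≤ 1 * (ε * t * ‖den t‖ * δ) :=
          mul_le_mul (hnum1 _) hcub' (norm_nonneg _) zero_le_one
      _ = ε * (t * δ) * ‖den t‖ := by ring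
      _ = _ := by rw [hδt]
  have hconst := constant_of_has_deriv_right_zero hRc.continuousOn hderiv 1
    (right_mem_Icc.2 zero_le_one)
  have hz00 : ∀ e, z 0 e = 1 := fun e => by
    have : e • polyTest (dil 0 p) = 0 := by
      rw [dil_zero_left, ← polyTest_smul, smul_zero]
      ext x; simp [polyTest, peval]
    simp only [hz, this, c_zero]
  have hR1 : R 1 = 1 := by simp [hR, hnum, hden, hz00]
  rw [hR1] at hconst
  have hfin : num 1 / den 1 = 1 := by rw [hconst]; simp [hR]
  rw [div_eq_one_iff_eq (hden0 1)] at hfin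
  simpa only [hnum, hden, hz, dil_one_left] using hfin

end GFF

/-! ### Gaussian laws from the functional equation -/

theorem exists_deriv_eq_of_cubic {z : ℝ → ℂ} (hz : ContDiff ℝ 1 z) (h0 : z 0 = 1)
    (h1 : deriv z 0 = 0) (hne : ∀ a, z a ≠ 0)
    (hcub : ∀ a b c, z (a + b + c) * z a * z b * z c = z (a + b) * z (a + c) * z (b + c)) :
    ∃ m : ℂ, ∀ a, deriv z a = a * m * z a := by
  have hd : ∀ a, HasDerivAt z (deriv z a) a := fun a =>
    (hz.differentiable one_ne_zero a).hasDerivAt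
  have hadd : ∀ a b, deriv z (a + b) / z (a + b) = deriv z a / z a + deriv z b / z b := by
    intro a b
    have hsh : ∀ e, HasDerivAt (fun c => z (e + c)) (deriv z e) 0 := fun e => by
      have := hd (e + 0)
      rw [add_zero] at this
      exact HasDerivAt.comp_const_add e 0 (by rwa [add_zero])
    have hl := ((((hsh (a + b)).mul_const (z a)).mul_const (z b)).mul (hd 0))
    have hr := ((hsh a).const_mul (z (a + b))).mul (hsh b)
    have he : ((fun c => z (a + b + c) * z a * z b) * z : ℝ → ℂ) =
        (fun c => z (a + b) * z (a + c)) * fun c => z (b + c) := funext fun c => hcub a b c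
    have hu := (he ▸ hl).unique hr
    simp only [add_zero, h0, h1, mul_zero, mul_one] at hu
    have := hne a
    have := hne b
    have := hne (a + b)
    field_simp
    linear_combination hu
  have hc : Continuous fun a => deriv z a / z a :=
    (hz.continuous_deriv le_rfl).div hz.continuous hne
  let L : ℝ →L[ℝ] ℂ := (AddMonoidHom.mk' (fun a => deriv z a / z a) hadd).toRealLinearMap hc
  refine ⟨L 1, fun a => ?_⟩
  have hLa : L a = a * L 1 := by
    conv_lhs => rw [← mul_one a, ← smul_eq_mul, map_smul]
    exact Complex.real_smul
  rw [← hLa]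
  exact (div_mul_cancel₀ _ (hne a)).symm

theorem eq_exp_of_deriv_eq {z : ℝ → ℂ} {m : ℂ} (hz : Differentiable ℝ z) (h0 : z 0 = 1)
    (h : ∀ a, deriv z a = a * m * z a) (a : ℝ) : z a = Complex.exp (m * a ^ 2 / 2) := by
  have hE : ∀ x : ℝ, HasDerivAt (fun x : ℝ => Complex.exp (-(m * x ^ 2 / 2)))
      (Complex.exp (-(m * x ^ 2 / 2)) * -(m * x)) x := by
    intro x
    have h1 : HasDerivAt (fun x : ℝ => (x : ℂ)) 1 x := Complex.ofRealCLM.hasDerivAt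
    have h2 : HasDerivAt (fun x : ℝ => -(m * (x : ℂ) ^ 2 / 2)) (-(m * x)) x := by
      have h3 := (((h1.mul h1).const_mul m).div_const 2).neg
      have e1 : (fun x : ℝ => -(m * (x : ℂ) ^ 2 / 2)) =
          -fun x : ℝ => m * ((fun x : ℝ => (x : ℂ)) * fun x : ℝ => (x : ℂ)) x / 2 := by
        ext x; simp only [Pi.neg_apply, Pi.mul_apply]; ring
      have e2 : -(m * (x : ℂ)) = -(m * (1 * (x : ℂ) + x * 1) / 2) := by ring
      rw [e1, e2]
      exact h3
    exact h2.cexp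
  have hprod : ∀ x : ℝ, HasDerivAt (fun x : ℝ => z x * Complex.exp (-(m * x ^ 2 / 2))) 0 x := by
    intro x
    have h3 := (hz x).hasDerivAt.mul (hE x)
    have e : deriv z x * Complex.exp (-(m * x ^ 2 / 2)) +
        z x * (Complex.exp (-(m * x ^ 2 / 2)) * -(m * x)) = 0 := by
      rw [h x]; ring
    rw [e] at h3
    exact h3
  have hconst := is_const_of_deriv_eq_zero (fun x => (hprod x).differentiableAt)
    (fun x => (hprod x).deriv) a 0
  simp only [h0, Complex.ofReal_zero, ne_eq, OfNat.ofNat_ne_zero, not_false_eq_true, zero_pow,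
    mul_zero, zero_div, neg_zero, Complex.exp_zero, mul_one, Complex.exp_neg] at hconst
  rwa [mul_inv_eq_one₀ (Complex.exp_ne_zero _)] at hconst

theorem charFun_eq_of_cubic {μ : Measure ℝ} [IsProbabilityMeasure μ] (hμ : MemLp id 2 μ)
    (hmean : ∫ x, x ∂μ = 0) (hne : ∀ a, charFun μ a ≠ 0)
    (hcub : ∀ a b c, charFun μ (a + b + c) * charFun μ a * charFun μ b * charFun μ c =
      charFun μ (a + b) * charFun μ (a + c) * charFun μ (b + c)) (a : ℝ) :
    charFun μ a = Complex.exp (-((∫ x, x ^ 2 ∂μ : ℝ) : ℂ) * a ^ 2 / 2) := by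
  have hμ1 : MemLp id ((1 : ℕ) : ENNReal) μ := hμ.mono_exponent (by norm_num)
  have hμ2 : MemLp id ((2 : ℕ) : ENNReal) μ := by exact_mod_cast hμ
  have hz : ContDiff ℝ 1 (charFun μ) := by exact_mod_cast contDiff_charFun hμ1
  have h0 : charFun μ 0 = 1 := by simp
  have h1 : deriv (charFun μ) 0 = 0 := by
    rw [← iteratedDeriv_one, iteratedDeriv_charFun_zero hμ1]
    simp [hmean]
  obtain ⟨m, hm⟩ := exists_deriv_eq_of_cubic hz h0 h1 hne hcub
  have hdiff := hz.differentiable one_ne_zero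
  have h2 : iteratedDeriv 2 (charFun μ) 0 = m := by
    rw [iteratedDeriv_succ, iteratedDeriv_one, funext hm]
    have h3 : HasDerivAt (fun x : ℝ => (x : ℂ)) 1 0 := Complex.ofRealCLM.hasDerivAt
    have h4 := ((h3.mul_const m).mul (hdiff 0).hasDerivAt).deriv
    simp only [Complex.ofReal_zero, zero_mul, add_zero, one_mul, h0, mul_one] at h4
    exact h4
  rw [iteratedDeriv_charFun_zero hμ2, Complex.I_sq, neg_one_mul] at h2
  rw [eq_exp_of_deriv_eq hdiff h0 hm a, ← h2]

namespace GFF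

variable {d : ℕ} {Ω : Type} [MeasurableSpace Ω] {X : GFF d Ω}

theorem charFun_map_h {f : Euc d → ℝ} (hf : IsTestFun f) (a : ℝ) :
    charFun (Measure.map (X.h 0 1 f) X.P) a = X.c (a • f) := by
  rw [charFun_apply_real, integral_map (X.meas_h 0 1 f).aemeasurable (by fun_prop), c]
  refine integral_congr_ae ?_
  filter_upwards [X.lin_smul a f hf] with ω hω
  rw [hω]
  push_cast
  congr 1; ring

theorem c_smul_polyTest (hd : 2 ≤ d) (p : MvPolynomial (Fin d) ℝ) (a : ℝ) :
    X.c (a • polyTest p) = Complex.exp (-((X.N (polyTest p) : ℝ) : ℂ) ^ 2 * a ^ 2 / 2) := by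
  have hp := isTestFun_polyTest p
  have hm := X.meas_h 0 1 (polyTest p)
  have : IsProbabilityMeasure (Measure.map (X.h 0 1 (polyTest p)) X.P) :=
    Measure.isProbabilityMeasure_map hm.aemeasurable
  have h := charFun_eq_of_cubic (μ := Measure.map (X.h 0 1 (polyTest p)) X.P)
    ((memLp_map_measure_iff aestronglyMeasurable_id hm.aemeasurable).2 (memLp_h hp))
    (by rw [integral_map hm.aemeasurable (by fun_prop)]; exact X.centered 0 1 _ hp)
    (fun a => by rw [charFun_map_h hp]; exact c_ne_zero hd (hp.smul a))
    (fun a b c => by simp only [charFun_map_h hp]; exact c_smul_polyTest_cubic hd p a b c) a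
  rw [charFun_map_h hp, integral_map hm.aemeasurable (by fun_prop), ← N_sq hp] at h
  rw [h]
  push_cast
  rfl

theorem c_eq_exp (hd : 2 ≤ d) {f : Euc d → ℝ} (hf : IsTestFun f) (a : ℝ) :
    X.c (a • f) = Complex.exp (-((X.N f : ℝ) : ℂ) ^ 2 * a ^ 2 / 2) := by
  choose p hp using fun n : ℕ =>
    exists_N_sub_polyTest_le (X := X) hd hf (ε := 1 / ((n : ℝ) + 1)) (by positivity)
  have hlim : Tendsto (fun n => X.N (f - polyTest (p n))) atTop (𝓝 0) :=
    squeeze_zero (fun _ => N_nonneg) hp tendsto_one_div_add_atTop_nhds_zero_nat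
  have hN : Tendsto (fun n => X.N (polyTest (p n))) atTop (𝓝 (X.N f)) := by
    rw [tendsto_iff_norm_sub_tendsto_zero]
    refine squeeze_zero (fun _ => norm_nonneg _) (fun n => ?_) hlim
    rw [norm_sub_rev]
    exact abs_N_sub_N_le hf (isTestFun_polyTest _)
  have hc : Tendsto (fun n => X.c (a • polyTest (p n))) atTop (𝓝 (X.c (a • f))) := by
    rw [tendsto_iff_norm_sub_tendsto_zero]
    refine squeeze_zero (fun _ => norm_nonneg _) (fun n => ?_)
      (by simpa using hlim.const_mul |a|)
    rw [norm_sub_rev, ← N_smul a (hf.sub (isTestFun_polyTest _)), smul_sub]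
    exact norm_c_sub_le (hf.smul a) ((isTestFun_polyTest _).smul a)
  refine tendsto_nhds_unique hc ?_
  simp only [c_smul_polyTest hd]
  have hcont : Continuous fun x : ℝ => Complex.exp (-((x : ℝ) : ℂ) ^ 2 * a ^ 2 / 2) := by fun_prop
  exact (hcont.tendsto _).comp hN

theorem isCenteredGaussianRV_h (hd : 2 ≤ d) {f : Euc d → ℝ} (hf : IsTestFun f) :
    IsCenteredGaussianRV X.P (X.h 0 1 f) := by
  have : IsProbabilityMeasure (Measure.map (X.h 0 1 f) X.P) :=
    Measure.isProbabilityMeasure_map (X.meas_h 0 1 f).aemeasurable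
  refine ⟨(X.N f ^ 2).toNNReal, Measure.ext_of_charFun (funext fun a => ?_)⟩
  rw [charFun_map_h hf, c_eq_exp hd hf, charFun_gaussianReal,
    Real.coe_toNNReal _ (sq_nonneg _)]
  congr 1
  push_cast
  ring

theorem h_sum_ae_eq {ι : Type*} (s : Finset ι) {f : ι → Euc d → ℝ} (hf : ∀ i, IsTestFun (f i))
    (lam : ι → ℝ) :
    X.h 0 1 (∑ i ∈ s, lam i • f i) =ᵐ[X.P] fun ω => ∑ i ∈ s, lam i * X.h 0 1 (f i) ω := by
  classical
  induction s using Finset.induction_on with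
  | empty =>
    have h := X.lin_smul 0 0 isTestFun_zero
    filter_upwards [h] with ω hω
    simpa using hω
  | insert i s hi ih =>
    rw [Finset.sum_insert hi]
    filter_upwards [X.lin_add _ _ ((hf i).smul (lam i))
      (IsTestFun.sum s fun j _ => (hf j).smul (lam j)), X.lin_smul (lam i) _ (hf i), ih]
      with ω h1 h2 h3
    rw [h1, h2, h3, Finset.sum_insert hi]

end GFF

/-- `(h^𝔹, f)` is a Gaussian process: every finite linear combination is a
centered Gaussian random variable. -/
theorem statement19 (d : ℕ) (hd : 2 ≤ d) (Ω : Type) [MeasurableSpace Ω] (X : GFF d Ω) (k : ℕ) (f : Fin k → Euc d → ℝ)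
    (hf : ∀ i, IsTestFun (f i)) (lam : Fin k → ℝ) :
    IsCenteredGaussianRV X.P (fun ω => ∑ i, lam i * X.h 0 1 (f i) ω) := by
  obtain ⟨v, hv⟩ := GFF.isCenteredGaussianRV_h (X := X) hd
    (IsTestFun.sum Finset.univ fun j _ => (hf j).smul (lam j))
  exact ⟨v, by rw [← hv, Measure.map_congr (GFF.h_sum_ae_eq Finset.univ hf lam)]⟩
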